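/- arXiv:1910.14027 — 6 statements merged into one kernel-verified Lean document; each statement's English description precedes it below -/
import Mathlib

section
/- Let A be a Banach algebra and η an infinite cardinal. If the quotient space A*/W(A) has ℓ∞(η) as a quotient and ℓ∞(η) contains an isomorphic copy of A*, then A is extremely non-Arens regular. -/
open Filter Topology
open scoped ENNReal

noncomputable section

universe u

namespace Paper

/-- The density character of a topological space: the smallest cardinality of a dense subset. -/
def densityChar (E : Type u) [TopologicalSpace E] : Cardinal.{u} :=
  ⨅ s : {s : Set E // Dense s}, Cardinal.mk ↥(s.1)

/-- A subset of a preordered set is cofinal if every element lies below some member of it. -/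
def Cofinal {Λ : Type*} [Preorder Λ] (S : Set Λ) : Prop :=
  ∀ ξ : Λ, ∃ α ∈ S, ξ ≤ α

/-- The true cardinality `tr|Λ| = min_{ξ ∈ Λ} |{α : ξ ≺ α}|` of a preordered set. -/
def trueCard (Λ : Type u) [Preorder Λ] : Cardinal.{u} :=
  ⨅ ξ : Λ, Cardinal.mk {α : Λ // ξ < α}

variable (𝕜 : Type u) [RCLike 𝕜]

/-- An `ℓ¹(η)`-base with constant `K` in a normed space: a bounded set of cardinality `η`
such that `∑ |zₙ| ≤ K ‖∑ zₙ aₙ‖` for all scalars and all finite families of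
distinct elements of the set. -/
def IsL1Base {E : Type u} [SeminormedAddCommGroup E] [NormedSpace 𝕜 E]
    (η : Cardinal.{u}) (K : ℝ) (X : Set E) : Prop :=
  Cardinal.mk ↥X = η ∧ (∃ M : ℝ, ∀ x ∈ X, ‖x‖ ≤ M) ∧
    ∀ (p : ℕ) (z : Fin p → 𝕜) (x : Fin p → E), Function.Injective x →
      (∀ n, x n ∈ X) → ∑ n, ‖z n‖ ≤ K * ‖∑ n, z n • x n‖

variable (A : Type u) [NonUnitalNormedRing A] [NormedSpace 𝕜 A]
  [IsScalarTower 𝕜 A A] [SMulCommClass 𝕜 A A]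

/-- The right action of `A` on `A*`:  `(fφ)(ψ) = f(φψ)`. -/
def lAct (f : A →L[𝕜] 𝕜) (φ : A) : A →L[𝕜] 𝕜 :=
  f.comp (ContinuousLinearMap.mul 𝕜 A φ)

/-- A functional `f ∈ A*` is weakly almost periodic when its left orbit
`{fφ : ‖φ‖ ≤ 1}` is relatively compact in the weak topology `σ(A*, A**)`. -/
def IsWAP (f : A →L[𝕜] 𝕜) : Prop :=
  IsCompact (closure ((toWeakSpace 𝕜 (A →L[𝕜] 𝕜)) ''
    {g | ∃ φ : A, ‖φ‖ ≤ 1 ∧ g = lAct 𝕜 A f φ}))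

/-- `W(A)`: the closed linear subspace of `A*` spanned by the weakly almost periodic
functionals. -/
def WAP : Submodule 𝕜 (A →L[𝕜] 𝕜) :=
  (Submodule.span 𝕜 {f | IsWAP 𝕜 A f}).topologicalClosure

instance WAP_isClosed : IsClosed ((WAP 𝕜 A : Submodule 𝕜 (A →L[𝕜] 𝕜)) : Set (A →L[𝕜] 𝕜)) :=
  Submodule.isClosed_topologicalClosure _

/-- A Banach algebra is extremely non-Arens regular when `A*/W(A)` contains a closed
subspace which has `A*` as a quotient (i.e. admits a bounded linear surjection onto `A*`). -/
def ExtremelyNonArensRegular : Prop :=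
  ∃ S : Submodule 𝕜 ((A →L[𝕜] 𝕜) ⧸ WAP 𝕜 A),
    IsClosed (S : Set ((A →L[𝕜] 𝕜) ⧸ WAP 𝕜 A)) ∧
    ∃ T : ↥S →L[𝕜] (A →L[𝕜] 𝕜), Function.Surjective T

end Paper

namespace Paper

/-- If `Q` maps continuously and linearly onto `F`, and `F` contains an isomorphic copy of a Banach
space `E`, then a closed subspace of `Q` maps continuously and linearly onto `E`. -/
theorem exists_isClosed_submodule_surjective {𝕜 Q F E : Type*} [NontriviallyNormedField 𝕜]
    [SeminormedAddCommGroup Q] [NormedSpace 𝕜 Q] [NormedAddCommGroup F] [NormedSpace 𝕜 F]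
    [NormedAddCommGroup E] [NormedSpace 𝕜 E] [CompleteSpace E]
    (T : Q →L[𝕜] F) (hT : Function.Surjective T) (J : E →ₗ[𝕜] F) {K₁ K₂ : ℝ} (hK₁ : 0 < K₁)
    (hlower : ∀ f, K₁ * ‖f‖ ≤ ‖J f‖) (hupper : ∀ f, ‖J f‖ ≤ K₂ * ‖f‖) :
    ∃ S : Submodule 𝕜 Q, IsClosed (S : Set Q) ∧ ∃ R : S →L[𝕜] E, Function.Surjective R := by
  have hbound : ∀ f, ‖f‖ ≤ K₁⁻¹ * ‖J f‖ := fun f => by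
    rw [inv_mul_eq_div, le_div_iff₀' hK₁]
    exact hlower f
  have hanti : AntilipschitzWith (K₁⁻¹).toNNReal J :=
    AddMonoidHomClass.antilipschitz_of_bound J fun f => by
      rw [Real.coe_toNNReal _ (inv_nonneg.2 hK₁.le)]
      exact hbound f
  have hclosed : IsClosed (LinearMap.range J : Set F) := by
    rw [LinearMap.coe_range]
    exact hanti.isClosed_range (J.mkContinuous K₂ hupper).uniformContinuous
  let e := LinearEquiv.ofInjective J hanti.injective
  let S : Submodule 𝕜 Q := (LinearMap.range J).comap (T : Q →ₗ[𝕜] F)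
  have hJe : ∀ y, J (e.symm y) = y := fun y => congrArg Subtype.val (e.apply_symm_apply y)
  let R : S →ₗ[𝕜] E :=
    e.symm.toLinearMap ∘ₗ (T : Q →ₗ[𝕜] F).restrict (q := LinearMap.range J) fun _ hx => hx
  have hJR : ∀ x, J (R x) = T x := fun x => hJe _
  refine ⟨S, hclosed.preimage T.continuous, R.mkContinuous (K₁⁻¹ * ‖T‖) fun x => ?_, fun f => ?_⟩
  · calc ‖R x‖ ≤ K₁⁻¹ * ‖T x‖ := hJR x ▸ hbound (R x)
      _ ≤ K₁⁻¹ * (‖T‖ * ‖x‖) := by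
        gcongr
        exact T.le_opNorm _
      _ = K₁⁻¹ * ‖T‖ * ‖x‖ := (mul_assoc _ _ _).symm
  · obtain ⟨x, hx⟩ := hT (J f)
    exact ⟨⟨x, f, hx.symm⟩, hanti.injective ((hJR _).trans hx)⟩

/-- if `A*/W(A)` has `ℓ∞(η)` as a quotient and `ℓ∞(η)` contains an
isomorphic copy of `A*`, then `A` is extremely non-Arens regular. -/
theorem statement1 (𝕜 A : Type u) [RCLike 𝕜] [NonUnitalNormedRing A] [NormedSpace 𝕜 A]
    [IsScalarTower 𝕜 A A] [SMulCommClass 𝕜 A A] [CompleteSpace A]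
    (η : Cardinal.{u}) (hη : Cardinal.aleph0 ≤ η)
    (ι : Type u) (hι : Cardinal.mk ι = η)
    (hquot : ∃ T : ((A →L[𝕜] 𝕜) ⧸ WAP 𝕜 A) →L[𝕜] lp (fun _ : ι => 𝕜) ∞,
      Function.Surjective T)
    (hembed : ∃ (T : (A →L[𝕜] 𝕜) →ₗ[𝕜] lp (fun _ : ι => 𝕜) ∞) (K₁ K₂ : ℝ),
      0 < K₁ ∧ 0 < K₂ ∧ ∀ f : A →L[𝕜] 𝕜, K₁ * ‖f‖ ≤ ‖T f‖ ∧ ‖T f‖ ≤ K₂ * ‖f‖) :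
    ExtremelyNonArensRegular 𝕜 A := by
  obtain ⟨T, hT⟩ := hquot
  obtain ⟨J, K₁, K₂, hK₁, -, hJ⟩ := hembed
  exact exists_isClosed_submodule_surjective (Q := (A →L[𝕜] 𝕜) ⧸ WAP 𝕜 A) T hT J hK₁ (fun f => (hJ f).1) fun f => (hJ f).2

end Paper
end
end

section
/- Let A be a Banach algebra and η an infinite cardinal. Suppose A contains bounded subsets A = {a_α : α ∈ Λ₁} and B = {b_β : β ∈ Λ₂} indexed by cofinal subsets Λ₁, Λ₂ of a common directed set (Λ,⪯) with tr|Λ₁| = tr|Λ₂| = η, and two disjoint subsets X₁, X₂ of A such that: (i) X = X₁ ∪ X₂ is an ℓ¹(η)-base in A with constant K > 0, contained in the closed ball of radius M > 0; (ii) X₁ approximates segments in the upper triangle T^u_{AB} and X₂ approximates segments in the lower triangle T^l_{AB}; (iii) either X₁ is vertically injective and X₂ is horizontally injective, or vice versa. Then, denoting by ⟨X⟩ the closed linear span of X, there exists a linear map I : ℓ∞(η) → ⟨X⟩* such that ‖I(c)‖ ≤ K‖c‖_∞ and ‖I(c) − f|_{⟨X⟩}‖ ≥ ‖c‖_∞/M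 for every c ∈ ℓ∞(η) and every weakly almost periodic functional f ∈ A*. Consequently, ℓ∞(η) embeds as a linear isomorphism into the quotient of ⟨X⟩* by the closure of the space of restrictions to ⟨X⟩ of weakly almost periodic functionals, and in particular A is not Arens regular (W(A) ≠ A*). -/
open Filter Topology
open scoped ENNReal

noncomputable section

universe u

namespace Paper

variable (𝕜 : Type u) [RCLike 𝕜] (A : Type u) [NonUnitalNormedRing A] [NormedSpace 𝕜 A]
  [IsScalarTower 𝕜 A A] [SMulCommClass 𝕜 A A]

/-- Restriction of functionals on `A` to a subspace `p`. -/
def restrictDual (p : Submodule 𝕜 A) : (A →L[𝕜] 𝕜) →ₗ[𝕜] (↥p →L[𝕜] 𝕜) where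
  toFun f := f.comp p.subtypeL
  map_add' f g := by ext x; rfl
  map_smul' c f := by ext x; rfl

/-- The closed linear span `⟨X⟩` of a subset of `A`. -/
def closedSpan (X : Set A) : Submodule 𝕜 A := (Submodule.span 𝕜 X).topologicalClosure

/-- The closure in `⟨X⟩*` of the space of restrictions to `⟨X⟩` of the weakly almost
periodic functionals on `A`. -/
def WAPrestrict (p : Submodule 𝕜 A) : Submodule 𝕜 (↥p →L[𝕜] 𝕜) :=
  ((WAP 𝕜 A).map (restrictDual 𝕜 A p)).topologicalClosure

/-- A family of sets, each at least as large as the index type, has an injective choice function. -/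
theorem exists_injective_choice {T P : Type u} (B : T → Set P)
    (hB : ∀ t, Cardinal.mk T ≤ Cardinal.mk ↥(B t)) :
    ∃ g : T → P, Function.Injective g ∧ ∀ t, g t ∈ B t := by
  obtain ⟨r, wo, hr⟩ := Cardinal.exists_ord_eq T
  have key : ∀ (t : T) (g : {s // r s t} → P), ∃ y ∈ B t, ∀ s, g s ≠ y := by
    intro t g
    by_contra! h
    have hsub : B t ⊆ Set.range g := fun y hy => h y hy
    have h1 : Cardinal.mk ↥(B t) ≤ Cardinal.mk {s // r s t} :=
      (Cardinal.mk_le_mk_of_subset hsub).trans Cardinal.mk_range_le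
    have h2 : Cardinal.mk {s // r s t} < Cardinal.mk T := Cardinal.card_typein_lt t hr
    exact absurd ((hB t).trans h1) (not_le.mpr h2)
  choose F hF hne using key
  let g : T → P := wo.wf.fix fun t ih => F t fun s => ih s.1 s.2
  have hg : ∀ t, g t = F t fun s => g s.1 := fun t => wo.wf.fix_eq _ t
  have hlt : ∀ s t, r s t → g s ≠ g t := by
    intro s t hst
    rw [hg t]
    exact hne t (fun s => g s.1) ⟨s, hst⟩
  refine ⟨g, fun s t hst => ?_, fun t => hg t ▸ hF t _⟩
  rcases trichotomous_of r s t with h | h | h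
  · exact absurd hst (hlt s t h)
  · exact h
  · exact absurd hst.symm (hlt t s h)

/-- A directed set of infinite true cardinality `η` contains `η` pairwise disjoint cofinal sets. -/
theorem exists_pairwise_disjoint_cofinal {ι P : Type u} [Preorder P] [IsDirected P (· ≤ ·)]
    [Nonempty P] (hη : Cardinal.aleph0 ≤ Cardinal.mk ι) (htr : trueCard P = Cardinal.mk ι) :
    ∃ S : ι → Set P, (∀ i j α, α ∈ S i → α ∈ S j → i = j) ∧ ∀ i, Cofinal (S i) := by
  obtain ⟨ξ, hξ⟩ : trueCard P ∈ Set.range fun ξ : P => Cardinal.mk {α : P // ξ < α} :=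
    ciInf_mem _
  have hle : ∀ ζ : P, Cardinal.mk ι ≤ Cardinal.mk {α : P // ζ < α} := fun ζ =>
    htr ▸ ciInf_le' _ ζ
  have hQ : Cardinal.mk {α : P // ξ < α} = Cardinal.mk ι := hξ.trans htr
  have hT : Cardinal.mk (ι × {α : P // ξ < α}) = Cardinal.mk ι := by
    rw [Cardinal.mk_prod, Cardinal.lift_id, Cardinal.lift_id, hQ, Cardinal.mul_eq_self hη]
  obtain ⟨g, hg, hgt⟩ := exists_injective_choice
    (fun t : ι × {α : P // ξ < α} => {α : P | t.2.1 < α}) (fun t => hT.trans_le (hle t.2.1))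
  have hne : Nonempty {α : P // ξ < α} := by
    rw [← Cardinal.mk_ne_zero_iff, hQ]
    exact (Cardinal.aleph0_pos.trans_le hη).ne'
  obtain ⟨q⟩ := hne
  refine ⟨fun i => Set.range fun q => g (i, q), ?_, fun i ζ => ?_⟩
  · rintro i j α ⟨q, rfl⟩ ⟨q', h⟩
    exact (congrArg Prod.fst (hg h)).symm
  · obtain ⟨γ, h1, h2⟩ := exists_ge_ge ζ q.1
    exact ⟨_, ⟨⟨γ, q.2.trans_le h2⟩, rfl⟩, h1.trans (hgt (i, ⟨γ, q.2.trans_le h2⟩)).le⟩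

theorem Cofinal.isDirected {Λ : Type*} [Preorder Λ] [IsDirected Λ (· ≤ ·)] {S : Set Λ}
    (hS : Cofinal S) : IsDirected ↥S (· ≤ ·) := by
  refine ⟨fun x y => ?_⟩
  obtain ⟨z, hx, hy⟩ := exists_ge_ge (x : Λ) y
  obtain ⟨w, hw, hzw⟩ := hS z
  exact ⟨⟨w, hw⟩, hx.trans hzw, hy.trans hzw⟩

theorem Cofinal.nonempty {Λ : Type*} [Preorder Λ] [Nonempty Λ] {S : Set Λ}
    (hS : Cofinal S) : Nonempty ↥S := by
  obtain ⟨α, hα, -⟩ := hS (Classical.arbitrary Λ)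
  exact ⟨⟨α, hα⟩⟩

/-- A cofinal subset of a directed set carries an ultrafilter converging to infinity. -/
theorem Cofinal.exists_ultrafilter {Λ : Type*} [Preorder Λ] [IsDirected Λ (· ≤ ·)] [Nonempty Λ]
    {S : Set Λ} (hS : Cofinal S) :
    ∃ F : Ultrafilter Λ, (↑F : Filter Λ) ≤ atTop ∧ ∀ᶠ α in (↑F : Filter Λ), α ∈ S := by
  have : NeBot (atTop ⊓ 𝓟 S) := by
    rw [← frequently_mem_iff_neBot, frequently_atTop]
    intro ξ
    obtain ⟨α, hα, h⟩ := hS ξ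
    exact ⟨α, h, hα⟩
  refine ⟨Ultrafilter.of (atTop ⊓ 𝓟 S), (Ultrafilter.of_le _).trans inf_le_left, ?_⟩
  exact (Ultrafilter.of_le _).trans inf_le_right (mem_principal_self S)

section

variable {𝕜 A}

theorem IsL1Base.sum_norm_le {E : Type u} [SeminormedAddCommGroup E] [NormedSpace 𝕜 E]
    {η : Cardinal.{u}} {K : ℝ} {X : Set E} (h : IsL1Base 𝕜 η K X) (z : ↥X →₀ 𝕜) :
    (z.sum fun _ w => ‖w‖) ≤ K * ‖z.sum fun x w => w • (x : E)‖ := by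
  let e := z.support.equivFin.symm
  have := h.2.2 z.support.card (fun n => z (e n)) (fun n => ((e n : ↥X) : E))
    (Subtype.val_injective.comp (Subtype.val_injective.comp e.injective))
    (fun n => (e n : ↥X).2)
  rw [e.sum_comp (fun s : z.support => ‖z s‖),
    e.sum_comp (fun s : z.support => z s • ((s : ↥X) : E)),
    Finset.sum_coe_sort z.support (fun x => ‖z x‖),
    Finset.sum_coe_sort z.support (fun x => z x • (x : E))] at this
  exact this

omit [IsScalarTower 𝕜 A A] [SMulCommClass 𝕜 A A] in
theorem mem_closedSpan {X : Set A} {x : A} (hx : x ∈ X) : x ∈ closedSpan 𝕜 A X :=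
  Submodule.le_topologicalClosure _ (Submodule.subset_span hx)

omit [IsScalarTower 𝕜 A A] [SMulCommClass 𝕜 A A] in
theorem denseRange_linearCombination_closedSpan (X : Set A) :
    DenseRange (Finsupp.linearCombination 𝕜
      (fun x : ↥X => (⟨x, mem_closedSpan x.2⟩ : ↥(closedSpan 𝕜 A X)))) := by
  rw [DenseRange, Subtype.dense_iff]
  have : Subtype.val '' Set.range (Finsupp.linearCombination 𝕜
      (fun x : ↥X => (⟨x, mem_closedSpan x.2⟩ : ↥(closedSpan 𝕜 A X)))) =
      (Submodule.span 𝕜 X : Set A) := by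
    rw [← Set.range_comp, ← Set.image_univ, Finsupp.span_eq_range_linearCombination]
    rw [Set.image_univ]
    ext y
    simp only [Set.mem_range, Function.comp, SetLike.mem_coe, LinearMap.mem_range]
    simp [Finsupp.linearCombination_apply, Finsupp.sum, AddSubmonoidClass.coe_finsetSum]
  exact (congrArg closure this).ge

omit [IsScalarTower 𝕜 A A] [SMulCommClass 𝕜 A A] in
/-- Prescribing values on an `ℓ¹(η)`-base, linearly in a parameter `c`, defines a bounded
family of functionals on its closed linear span. -/
theorem IsL1Base.exists_linearMap_dual {V : Type*} [SeminormedAddCommGroup V] [NormedSpace 𝕜 V]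
    {η : Cardinal.{u}} {K : ℝ} (hK : 0 ≤ K) {X : Set A} (h : IsL1Base 𝕜 η K X)
    (θ : ↥X → V →ₗ[𝕜] 𝕜) (hθ : ∀ x c, ‖θ x c‖ ≤ ‖c‖) :
    ∃ I : V →ₗ[𝕜] (↥(closedSpan 𝕜 A X) →L[𝕜] 𝕜), (∀ c, ‖I c‖ ≤ K * ‖c‖) ∧
      ∀ c (x : ↥X), I c ⟨x, mem_closedSpan x.2⟩ = θ x c := by
  let e := Finsupp.linearCombination 𝕜
    (fun x : ↥X => (⟨x, mem_closedSpan x.2⟩ : ↥(closedSpan 𝕜 A X)))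
  have he : DenseRange e := denseRange_linearCombination_closedSpan X
  let φ : V → (↥X →₀ 𝕜) →ₗ[𝕜] 𝕜 := fun c => Finsupp.linearCombination 𝕜 fun x => θ x c
  have hbd : ∀ c z, ‖φ c z‖ ≤ (K * ‖c‖) * ‖e z‖ := by
    intro c z
    calc ‖φ c z‖ ≤ z.sum fun x w => ‖w‖ * ‖c‖ := by
          simp only [φ, Finsupp.linearCombination_apply, Finsupp.sum]
          refine (norm_sum_le _ _).trans (Finset.sum_le_sum fun x _ => ?_)
          rw [norm_smul]
          gcongr
          exact hθ x c
      _ = (z.sum fun _ w => ‖w‖) * ‖c‖ := by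
          simp only [Finsupp.sum, Finset.sum_mul]
      _ ≤ (K * ‖z.sum fun x w => w • (x : A)‖) * ‖c‖ := by
          gcongr
          exact h.sum_norm_le z
      _ = (K * ‖c‖) * ‖e z‖ := by
          have : ((e z : ↥(closedSpan 𝕜 A X)) : A) = z.sum fun x w => w • (x : A) := by
            simp [e, Finsupp.linearCombination_apply, Finsupp.sum,
              AddSubmonoidClass.coe_finsetSum]
          rw [← this, Submodule.coe_norm]
          ring
  have heq : ∀ c z, (φ c).extendOfNorm e (e z) = φ c z := fun c z =>
    LinearMap.extendOfNorm_eq he ⟨_, hbd c⟩ z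
  have hext : ∀ f g : ↥(closedSpan 𝕜 A X) →L[𝕜] 𝕜, (∀ z, f (e z) = g (e z)) → f = g :=
    fun f g hfg => ContinuousLinearMap.coeFn_injective
      (he.equalizer f.continuous g.continuous (funext hfg))
  refine ⟨{ toFun := fun c => (φ c).extendOfNorm e
            map_add' := fun c d => hext _ _ fun z => ?_
            map_smul' := fun k c => hext _ _ fun z => ?_ }, fun c => ?_, fun c x => ?_⟩
  · rw [add_apply, heq, heq, heq]
    simp [φ, Finsupp.linearCombination_apply, Finsupp.sum, mul_add, Finset.sum_add_distrib]
  · rw [RingHom.id_apply, smul_apply, heq, heq]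
    simp [φ, Finsupp.linearCombination_apply, Finsupp.sum, Finset.mul_sum, mul_left_comm]
  · exact LinearMap.opNorm_extendOfNorm_le he (by positivity) (hbd c)
  · have := heq c (Finsupp.single x 1)
    simpa [e, φ] using this

/-- Bounded families in a normed space have bidual limits along ultrafilters. -/
theorem exists_bidual_limit {E : Type*} [NormedAddCommGroup E] [NormedSpace 𝕜 E] {J : Type*}
    (G : Ultrafilter J) (b : J → E) {C : ℝ} (hb : ∀ β, ‖b β‖ ≤ C) :
    ∃ Φ : (E →L[𝕜] 𝕜) →L[𝕜] 𝕜, ∀ h : E →L[𝕜] 𝕜,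
      Tendsto (fun β => h (b β)) G (𝓝 (Φ h)) := by
  let u : J → WeakDual 𝕜 (E →L[𝕜] 𝕜) := fun β =>
    StrongDual.toWeakDual (NormedSpace.inclusionInDoubleDual 𝕜 E (b β))
  have hu : ∀ β, u β ∈ WeakDual.toStrongDual ⁻¹' Metric.closedBall
      (0 : StrongDual 𝕜 (E →L[𝕜] 𝕜)) C := by
    intro β
    exact (mem_closedBall_zero_iff (E := StrongDual 𝕜 (E →L[𝕜] 𝕜))).2
      ((NormedSpace.double_dual_bound 𝕜 E (b β)).trans (hb β))
  obtain ⟨Φ, -, hΦ⟩ := (WeakDual.isCompact_closedBall (𝕜 := 𝕜)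
    (0 : StrongDual 𝕜 (E →L[𝕜] 𝕜)) C).ultrafilter_le_nhds (G.map u)
    (le_principal_iff.2 (Filter.mem_map.2 (Filter.univ_mem' hu)))
  exact ⟨WeakDual.toStrongDual Φ, fun h => ((WeakDual.eval_continuous h).tendsto Φ).comp hΦ⟩

/-- Translates of a weakly almost periodic functional by a bounded family converge weakly along
ultrafilters. -/
theorem exists_weak_limit_lAct {J : Type*} (F : Ultrafilter J) (a : J → A) {C : ℝ}
    (ha : ∀ α, ‖a α‖ ≤ C) {f : A →L[𝕜] 𝕜}
    (hf : f ∈ Submodule.span 𝕜 {f | IsWAP 𝕜 A f}) :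
    ∃ g : A →L[𝕜] 𝕜, ∀ Φ : (A →L[𝕜] 𝕜) →L[𝕜] 𝕜,
      Tendsto (fun α => Φ (lAct 𝕜 A f (a α))) F (𝓝 (Φ g)) := by
  induction hf using Submodule.span_induction with
  | mem f hf =>
    have hC : 0 < max C 1 := lt_max_of_lt_right one_pos
    set D : 𝕜 := ((max C 1 : ℝ) : 𝕜) with hD
    have hD0 : D ≠ 0 := by simpa [hD] using hC.ne'
    let u : J → WeakSpace 𝕜 (A →L[𝕜] 𝕜) := fun α =>
      toWeakSpace 𝕜 (A →L[𝕜] 𝕜) (lAct 𝕜 A f (D⁻¹ • a α))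
    have hu : ∀ α, u α ∈ closure ((toWeakSpace 𝕜 (A →L[𝕜] 𝕜)) ''
        {g | ∃ φ : A, ‖φ‖ ≤ 1 ∧ g = lAct 𝕜 A f φ}) := by
      intro α
      refine subset_closure ⟨_, ⟨_, ?_, rfl⟩, rfl⟩
      rw [norm_smul, norm_inv, hD, RCLike.norm_ofReal, abs_of_pos hC, inv_mul_le_one₀ hC]
      exact (ha α).trans (le_max_left _ _)
    obtain ⟨g, -, hg⟩ := IsCompact.ultrafilter_le_nhds hf (F.map u)
      (le_principal_iff.2 (Filter.mem_map.2 (Filter.univ_mem' hu)))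
    refine ⟨D • (toWeakSpace 𝕜 (A →L[𝕜] 𝕜)).symm g, fun Φ => ?_⟩
    have h1 : Tendsto (fun α => Φ (lAct 𝕜 A f (D⁻¹ • a α))) F
        (𝓝 (Φ ((toWeakSpace 𝕜 (A →L[𝕜] 𝕜)).symm g))) :=
      ((WeakBilin.eval_continuous (topDualPairing 𝕜 (A →L[𝕜] 𝕜)).flip Φ).tendsto g).comp hg
    have h2 : ∀ α, Φ (lAct 𝕜 A f (a α)) = D * Φ (lAct 𝕜 A f (D⁻¹ • a α)) := by
      intro α
      have : lAct 𝕜 A f (a α) = D • lAct 𝕜 A f (D⁻¹ • a α) := by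
        ext y
        simp [lAct, hD0]
      rw [this, map_smul, smul_eq_mul]
    simp only [h2, map_smul, smul_eq_mul]
    exact h1.const_mul D
  | zero =>
    refine ⟨0, fun Φ => ?_⟩
    have : ∀ α, lAct 𝕜 A (0 : A →L[𝕜] 𝕜) (a α) = 0 := fun α => by ext; simp [lAct]
    simp [this]
  | add f f' _ _ h h' =>
    obtain ⟨g, hg⟩ := h
    obtain ⟨g', hg'⟩ := h'
    refine ⟨g + g', fun Φ => ?_⟩
    have : ∀ α, lAct 𝕜 A (f + f') (a α) = lAct 𝕜 A f (a α) + lAct 𝕜 A f' (a α) := fun α => by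
      ext; simp [lAct]
    simpa [this] using (hg Φ).add (hg' Φ)
  | smul k f _ h =>
    obtain ⟨g, hg⟩ := h
    refine ⟨k • g, fun Φ => ?_⟩
    have : ∀ α, lAct 𝕜 A (k • f) (a α) = k • lAct 𝕜 A f (a α) := fun α => by
      ext; simp [lAct]
    simpa [this] using (hg Φ).const_mul k

omit [IsScalarTower 𝕜 A A] [SMulCommClass 𝕜 A A] in
theorem restrictDual_continuous (p : Submodule 𝕜 A) : Continuous (restrictDual 𝕜 A p) := by
  change Continuous fun f : A →L[𝕜] 𝕜 => f.comp p.subtypeL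
  fun_prop

/-- A lower bound on the distance to restrictions of weakly almost periodic functionals passes
to the closure `WAPrestrict`. -/
theorem le_norm_sub_of_mem_WAPrestrict {p : Submodule 𝕜 A} {g : ↥p →L[𝕜] 𝕜} {r : ℝ}
    (h : ∀ f ∈ Submodule.span 𝕜 {f | IsWAP 𝕜 A f}, r ≤ ‖g - restrictDual 𝕜 A p f‖)
    {w : ↥p →L[𝕜] 𝕜} (hw : w ∈ WAPrestrict 𝕜 A p) : r ≤ ‖g - w‖ := by
  refine closure_minimal (t := {w : ↥p →L[𝕜] 𝕜 | r ≤ ‖g - w‖}) ?_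
    (isClosed_le continuous_const (by fun_prop)) hw
  rintro _ ⟨f, hf, rfl⟩
  refine closure_minimal (t := {f : A →L[𝕜] 𝕜 | r ≤ ‖g - restrictDual 𝕜 A p f‖}) h
    (isClosed_le continuous_const ?_) hf
  exact (continuous_const.sub (restrictDual_continuous p)).norm

/-- The iterated limits of `f (a α * b β)` along two ultrafilters exist and agree when `f` is
weakly almost periodic. -/
theorem exists_iterated_limits {J J' : Type*} (F : Ultrafilter J) (G : Ultrafilter J')
    (a : J → A) (b : J' → A) {C : ℝ} (ha : ∀ α, ‖a α‖ ≤ C) (hb : ∀ β, ‖b β‖ ≤ C)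
    {f : A →L[𝕜] 𝕜} (hf : f ∈ Submodule.span 𝕜 {f | IsWAP 𝕜 A f}) :
    ∃ (L : 𝕜) (u : J → 𝕜) (v : J' → 𝕜),
      (∀ α, Tendsto (fun β => f (a α * b β)) G (𝓝 (u α))) ∧ Tendsto u F (𝓝 L) ∧
      (∀ β, Tendsto (fun α => f (a α * b β)) F (𝓝 (v β))) ∧ Tendsto v G (𝓝 L) := by
  obtain ⟨Φ, hΦ⟩ := exists_bidual_limit (𝕜 := 𝕜) G b hb
  obtain ⟨g, hg⟩ := exists_weak_limit_lAct F a ha hf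
  exact ⟨Φ g, fun α => Φ (lAct 𝕜 A f (a α)), fun β => g (b β),
    fun α => hΦ (lAct 𝕜 A f (a α)), hg Φ,
    fun β => hg (NormedSpace.inclusionInDoubleDual 𝕜 A (b β)), hΦ g⟩

omit [IsScalarTower 𝕜 A A] [SMulCommClass 𝕜 A A] in
/-- If `x α β` approximates `y α β` and `f (x α β)` eventually stays within `R` of `t`, then so does
the iterated limit of `f (y α β)`. -/
theorem norm_sub_le_of_iterated_limit {J J' : Type*} (F : Ultrafilter J) (G : Ultrafilter J')
    {y x : J → J' → A} {f : A →L[𝕜] 𝕜} {L t : 𝕜} {u : J → 𝕜} {R : ℝ}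
    (hu : ∀ α, Tendsto (fun β => f (y α β)) G (𝓝 (u α))) (hL : Tendsto u F (𝓝 L))
    (hx : ∀ᶠ α in F, Tendsto (fun β => x α β - y α β) G (𝓝 0))
    (hR : ∀ᶠ α in F, ∀ᶠ β in G, ‖t - f (x α β)‖ ≤ R) : ‖t - L‖ ≤ R := by
  refine le_of_tendsto (hL.const_sub t).norm ?_
  filter_upwards [hx, hR] with α hα hRα
  have h1 : Tendsto (fun β => f (x α β)) G (𝓝 (u α)) := by
    have := ((f.continuous.tendsto 0).comp hα).add (hu α)
    simpa [Function.comp_def] using this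
  exact le_of_tendsto (h1.const_sub t).norm hRα

/-- If indices with equal values lie in the same block, then values determine blocks. -/
theorem exists_label {ι J B : Type*} [Nonempty ι] {U : Set J} {x : J → B} {S : ι → Set J}
    (h : ∀ p ∈ U, ∀ q ∈ U, ∀ i j, p ∈ S i → q ∈ S j → x p = x q → i = j) :
    ∃ l : B → ι, ∀ p ∈ U, ∀ i, p ∈ S i → l (x p) = i := by
  refine ⟨fun y => Classical.epsilon fun i => ∃ p ∈ U, p ∈ S i ∧ x p = y, fun p hp i hi => ?_⟩
  obtain ⟨q, hq, hqi, hqx⟩ :=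
    Classical.epsilon_spec (p := fun i => ∃ q ∈ U, q ∈ S i ∧ x q = x p) ⟨i, p, hp, hi, rfl⟩
  exact h q hq p hp _ _ hqi hi hqx

end

/-- the main triangle criterion.  An `ℓ¹(η)`-base approximating upper and
lower triangles of products in a Banach algebra `A` produces a linear map
`I : ℓ∞(η) → ⟨X⟩*` with `‖I c‖ ≤ K ‖c‖` and `‖I c − f|⟨X⟩‖ ≥ ‖c‖/M` for every weakly almost
periodic `f`.  Consequently `ℓ∞(η)` embeds isomorphically into the quotient of `⟨X⟩*` by the
closure of the restrictions of the weakly almost periodic functionals — the second clause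
states exactly that the composition of `J` with the quotient map is a linear isomorphism
into that quotient, via the quotient norm `‖J c + R‖ = inf_{g ∈ R} ‖J c − g‖` — and in
particular `A` is not Arens regular. -/
theorem statement4
    (𝕜 A : Type u) [RCLike 𝕜] [NonUnitalNormedRing A] [NormedSpace 𝕜 A]
    [IsScalarTower 𝕜 A A] [SMulCommClass 𝕜 A A] [CompleteSpace A]
    (η : Cardinal.{u}) (hη : Cardinal.aleph0 ≤ η)
    (ι : Type u) (hι : Cardinal.mk ι = η)
    (Λ : Type u) [Preorder Λ] [Nonempty Λ] [IsDirected Λ (· ≤ ·)]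
    (Λ₁ Λ₂ : Set Λ) (hcof₁ : Cofinal Λ₁) (hcof₂ : Cofinal Λ₂)
    (htr₁ : trueCard ↥Λ₁ = η) (htr₂ : trueCard ↥Λ₂ = η)
    (a : ↥Λ₁ → A) (b : ↥Λ₂ → A)
    (Cab : ℝ) (ha : ∀ α, ‖a α‖ ≤ Cab) (hb : ∀ β, ‖b β‖ ≤ Cab)
    (X₁ X₂ : Set A) (hdisj : Disjoint X₁ X₂)
    (K M : ℝ) (hK : 0 < K) (hM : 0 < M)
    -- (i) `X = X₁ ∪ X₂` is an `ℓ¹(η)`-base with constant `K` inside the ball of radius `M`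
    (hbase : IsL1Base 𝕜 η K (X₁ ∪ X₂))
    (hball : X₁ ∪ X₂ ⊆ Metric.closedBall (0 : A) M)
    -- (ii) `X₁` approximates segments in the upper triangle `T^u_{AB}` …
    (U₁ : Set (↥Λ₁ × ↥Λ₂)) (x₁ : ↥Λ₁ → ↥Λ₂ → A)
    (hU₁lt : ∀ p ∈ U₁, (p.1 : Λ) < (p.2 : Λ))
    (hU₁cof : ∀ α : ↥Λ₁, ∃ β₀ : ↥Λ₂, ∀ β : ↥Λ₂, β₀ ≤ β → (α, β) ∈ U₁)
    (hX₁ : X₁ = {y : A | ∃ p ∈ U₁, y = x₁ p.1 p.2})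
    (hlim₁ : ∀ (α : ↥Λ₁) (ε : ℝ), 0 < ε → ∃ β₀ : ↥Λ₂, ∀ β : ↥Λ₂, β₀ ≤ β →
      (α, β) ∈ U₁ → ‖x₁ α β - a α * b β‖ < ε)
    -- … and `X₂` approximates segments in the lower triangle `T^l_{AB}`
    (U₂ : Set (↥Λ₁ × ↥Λ₂)) (x₂ : ↥Λ₁ → ↥Λ₂ → A)
    (hU₂lt : ∀ p ∈ U₂, (p.2 : Λ) < (p.1 : Λ))
    (hU₂cof : ∀ β : ↥Λ₂, ∃ α₀ : ↥Λ₁, ∀ α : ↥Λ₁, α₀ ≤ α → (α, β) ∈ U₂)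
    (hX₂ : X₂ = {y : A | ∃ p ∈ U₂, y = x₂ p.1 p.2})
    (hlim₂ : ∀ (β : ↥Λ₂) (ε : ℝ), 0 < ε → ∃ α₀ : ↥Λ₁, ∀ α : ↥Λ₁, α₀ ≤ α →
      (α, β) ∈ U₂ → ‖x₂ α β - a α * b β‖ < ε)
    -- (iii) either `X₁` is vertically injective and `X₂` horizontally injective, or vice versa
    (hinj :
      ((∀ p ∈ U₁, ∀ q ∈ U₁, x₁ p.1 p.2 = x₁ q.1 q.2 → p.2 = q.2) ∧
        (∀ p ∈ U₂, ∀ q ∈ U₂, x₂ p.1 p.2 = x₂ q.1 q.2 → p.1 = q.1)) ∨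
      ((∀ p ∈ U₁, ∀ q ∈ U₁, x₁ p.1 p.2 = x₁ q.1 q.2 → p.1 = q.1) ∧
        (∀ p ∈ U₂, ∀ q ∈ U₂, x₂ p.1 p.2 = x₂ q.1 q.2 → p.2 = q.2)))
    :
    (∃ I : lp (fun _ : ι => 𝕜) ∞ →ₗ[𝕜] (↥(closedSpan 𝕜 A (X₁ ∪ X₂)) →L[𝕜] 𝕜),
      (∀ c, ‖I c‖ ≤ K * ‖c‖) ∧
      ∀ (c) (f : A →L[𝕜] 𝕜), IsWAP 𝕜 A f →
        ‖c‖ / M ≤ ‖I c - restrictDual 𝕜 A (closedSpan 𝕜 A (X₁ ∪ X₂)) f‖) ∧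
    (∃ (J : lp (fun _ : ι => 𝕜) ∞ →ₗ[𝕜] (↥(closedSpan 𝕜 A (X₁ ∪ X₂)) →L[𝕜] 𝕜))
        (K₁ K₂ : ℝ), 0 < K₁ ∧ 0 < K₂ ∧
        (∀ c, ∀ g ∈ WAPrestrict 𝕜 A (closedSpan 𝕜 A (X₁ ∪ X₂)), K₁ * ‖c‖ ≤ ‖J c - g‖) ∧
        (∀ c, ‖J c‖ ≤ K₂ * ‖c‖)) ∧
    WAP 𝕜 A ≠ ⊤ := by
  subst hι
  have : Infinite ι := Cardinal.aleph0_le_mk_iff.1 hη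
  have := hcof₁.isDirected
  have := hcof₂.isDirected
  have := hcof₁.nonempty
  have := hcof₂.nonempty
  obtain ⟨S₁, hS₁, hS₁c⟩ := exists_pairwise_disjoint_cofinal hη htr₁
  obtain ⟨S₂, hS₂, hS₂c⟩ := exists_pairwise_disjoint_cofinal hη htr₂
  obtain ⟨l₁, hl₁⟩ : ∃ l : A → ι, ∀ p ∈ U₁, ∀ i, p ∈ S₁ i ×ˢ S₂ i → l (x₁ p.1 p.2) = i := by
    refine exists_label fun p hp q hq i j hi hj hpq => ?_
    rcases hinj with h | h
    · exact hS₂ i j p.2 hi.2 (h.1 p hp q hq hpq ▸ hj.2)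
    · exact hS₁ i j p.1 hi.1 (h.1 p hp q hq hpq ▸ hj.1)
  obtain ⟨l₂, hl₂⟩ : ∃ l : A → ι, ∀ p ∈ U₂, ∀ i, p ∈ S₁ i ×ˢ S₂ i → l (x₂ p.1 p.2) = i := by
    refine exists_label fun p hp q hq i j hi hj hpq => ?_
    rcases hinj with h | h
    · exact hS₁ i j p.1 hi.1 (h.2 p hp q hq hpq ▸ hj.1)
    · exact hS₂ i j p.2 hi.2 (h.2 p hp q hq hpq ▸ hj.2)
  have hmem₁ : ∀ p ∈ U₁, x₁ p.1 p.2 ∈ X₁ := fun p hp => hX₁ ▸ ⟨p, hp, rfl⟩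
  have hmem₂ : ∀ p ∈ U₂, x₂ p.1 p.2 ∈ X₂ := fun p hp => hX₂ ▸ ⟨p, hp, rfl⟩
  classical
  let ev : ι → lp (fun _ : ι => 𝕜) ∞ →ₗ[𝕜] 𝕜 := fun i => lp.evalₗ (𝕜 := 𝕜) (fun _ : ι => 𝕜) ∞ i
  have hev : ∀ i c, ‖ev i c‖ ≤ ‖c‖ := fun i c => lp.norm_apply_le_norm ENNReal.top_ne_zero c i
  obtain ⟨I, hIK, hI⟩ := hbase.exists_linearMap_dual hK.le
    (fun y => if (y : A) ∈ X₁ then ev (l₁ y) else -ev (l₂ y))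
    (fun y c => by
      split_ifs
      · exact hev _ c
      · simpa using hev _ c)
  have hclose : ∀ (c : lp (fun _ : ι => 𝕜) ∞) (f : A →L[𝕜] 𝕜) (y : ↥(X₁ ∪ X₂)),
      ‖(if (y : A) ∈ X₁ then ev (l₁ y) else -ev (l₂ y)) c - f y‖ ≤
        ‖I c - restrictDual 𝕜 A (closedSpan 𝕜 A (X₁ ∪ X₂)) f‖ * M := by
    intro c f y
    rw [← hI c y]
    refine ((I c - restrictDual 𝕜 A (closedSpan 𝕜 A (X₁ ∪ X₂)) f).le_opNorm
      ⟨y, mem_closedSpan y.2⟩).trans ?_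
    gcongr
    exact mem_closedBall_zero_iff.1 (hball y.2)
  have hspan : ∀ (c : lp (fun _ : ι => 𝕜) ∞), ∀ f ∈ Submodule.span 𝕜 {f | IsWAP 𝕜 A f},
      ‖c‖ / M ≤ ‖I c - restrictDual 𝕜 A (closedSpan 𝕜 A (X₁ ∪ X₂)) f‖ := by
    intro c f hf
    rw [div_le_iff₀ hM]
    refine lp.norm_le_of_forall_le (by positivity) fun i => ?_
    obtain ⟨F, hF, hFS⟩ := (hS₁c i).exists_ultrafilter
    obtain ⟨G, hG, hGS⟩ := (hS₂c i).exists_ultrafilter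
    obtain ⟨L, u, v, hu, huL, hv, hvL⟩ := exists_iterated_limits F G a b ha hb hf
    have h₁ : ‖c i - L‖ ≤ ‖I c - restrictDual 𝕜 A (closedSpan 𝕜 A (X₁ ∪ X₂)) f‖ * M := by
      refine norm_sub_le_of_iterated_limit F G (x := x₁) hu huL (.of_forall fun α => ?_) ?_
      · obtain ⟨β₁, hβ₁⟩ := hU₁cof α
        rw [Metric.tendsto_nhds]
        intro ε hε
        obtain ⟨β₀, hβ₀⟩ := hlim₁ α ε hε
        filter_upwards [hG (eventually_ge_atTop β₀), hG (eventually_ge_atTop β₁)] with β h h'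
        simpa using hβ₀ β h (hβ₁ β h')
      · filter_upwards [hFS] with α hα
        obtain ⟨β₁, hβ₁⟩ := hU₁cof α
        filter_upwards [hG (eventually_ge_atTop β₁), hGS] with β h hβ
        have hU := hβ₁ β h
        have := hclose c f ⟨x₁ α β, Or.inl (hmem₁ _ hU)⟩
        rw [if_pos (hmem₁ _ hU), hl₁ _ hU i ⟨hα, hβ⟩] at this
        exact this
    have h₂ : ‖-c i - L‖ ≤ ‖I c - restrictDual 𝕜 A (closedSpan 𝕜 A (X₁ ∪ X₂)) f‖ * M := by
      refine norm_sub_le_of_iterated_limit G F (x := fun β α => x₂ α β) hv hvL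
        (.of_forall fun β => ?_) ?_
      · obtain ⟨α₁, hα₁⟩ := hU₂cof β
        rw [Metric.tendsto_nhds]
        intro ε hε
        obtain ⟨α₀, hα₀⟩ := hlim₂ β ε hε
        filter_upwards [hF (eventually_ge_atTop α₀), hF (eventually_ge_atTop α₁)] with α h h'
        simpa using hα₀ α h (hα₁ α h')
      · filter_upwards [hGS] with β hβ
        obtain ⟨α₁, hα₁⟩ := hU₂cof β
        filter_upwards [hF (eventually_ge_atTop α₁), hFS] with α h hα
        have hU := hα₁ α h
        have := hclose c f ⟨x₂ α β, Or.inr (hmem₂ _ hU)⟩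
        rw [if_neg (hdisj.notMem_of_mem_right (hmem₂ _ hU)), hl₂ _ hU i ⟨hα, hβ⟩] at this
        exact this
    have h₃ : ‖c i + c i‖ ≤ ‖c i - L‖ + ‖-c i - L‖ := by
      have := norm_sub_le (c i - L) (-c i - L)
      rwa [show c i - L - (-c i - L) = c i + c i by ring] at this
    rw [← two_mul, norm_mul, RCLike.norm_ofNat] at h₃
    linarith
  have hdist : ∀ c, ∀ g ∈ WAPrestrict 𝕜 A (closedSpan 𝕜 A (X₁ ∪ X₂)), ‖c‖ / M ≤ ‖I c - g‖ :=
    fun c g hg => le_norm_sub_of_mem_WAPrestrict (hspan c) hg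
  refine ⟨⟨I, hIK, fun c f hf => hspan c f (Submodule.subset_span hf)⟩,
    ⟨I, M⁻¹, K, inv_pos.2 hM, hK, fun c g hg => ?_, hIK⟩, fun htop => ?_⟩
  · rw [inv_mul_eq_div]
    exact hdist c g hg
  · obtain ⟨i⟩ := (inferInstance : Nonempty ι)
    let c : lp (fun _ : ι => 𝕜) ∞ := lp.single ∞ i (1 : 𝕜)
    obtain ⟨f, hf, -⟩ := exists_extension_norm_eq (closedSpan 𝕜 A (X₁ ∪ X₂)) (I c)
    have hmem : I c ∈ WAPrestrict 𝕜 A (closedSpan 𝕜 A (X₁ ∪ X₂)) :=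
      Submodule.le_topologicalClosure _
        ⟨f, by rw [htop]; exact Submodule.mem_top, ContinuousLinearMap.ext hf⟩
    have h := hdist c (I c) hmem
    have hc : ‖c‖ = 1 := by
      simp [c, lp.norm_single]
    rw [sub_self, norm_zero, hc] at h
    exact absurd h (not_le.2 (by positivity))

end Paper
end
end

section
/- Let A be a Banach algebra and η an infinite cardinal. Suppose A contains a bounded approximate identity {a_α : α ∈ Λ}, indexed injectively by a directed set Λ of true cardinality η, which forms an ℓ¹(η)-base in A. Then: (i) there is a bounded linear surjection from A*/W(A) onto ℓ∞(η); (ii) in particular, A is not Arens regular; (iii) if in addition the density character d(A) ≤ η, then A is extremely non-Arens regular. -/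
open Filter Topology
open scoped ENNReal

noncomputable section

universe u

namespace Paper

/-- A family of `η` sets of cardinality at least `η` has distinct representatives. -/
theorem exists_injective_of_le_mk {P X : Type u} (t : P → Set X)
    (ht : ∀ p, Cardinal.mk P ≤ Cardinal.mk ↥(t p)) :
    ∃ h : P → X, Function.Injective h ∧ ∀ p, h p ∈ t p := by
  obtain ⟨_, _, hr⟩ := Cardinal.exists_ord_eq_type_lt P
  have key : ∀ (p : P) (g : ∀ q : P, q < p → X), ∃ x ∈ t p, ∀ q hq, g q hq ≠ x := by
    intro p g
    by_contra! hcon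
    have hle : Cardinal.mk ↥(t p) ≤ Cardinal.mk ↥(Set.Iio p) := by
      refine (Cardinal.mk_le_mk_of_subset ?_).trans
        (Cardinal.mk_range_le (f := fun q : Set.Iio p => g q.1 q.2))
      intro x hx
      obtain ⟨q, hq, rfl⟩ := hcon x hx
      exact ⟨⟨q, hq⟩, rfl⟩
    exact absurd ((ht p).trans hle) (not_le.mpr (Cardinal.mk_Iio_lt p hr))
  choose F hF hne using key
  have wf : WellFounded ((· < ·) : P → P → Prop) := wellFounded_lt
  have heq : ∀ p, wf.fix F p = F p (fun q _ => wf.fix F q) := fun p => wf.fix_eq F p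
  have hlt : ∀ p q, q < p → wf.fix F q ≠ wf.fix F p := by
    intro p q hq
    rw [heq p]
    exact hne p (fun q _ => wf.fix F q) q hq
  refine ⟨wf.fix F, fun p q hpq => ?_, fun p => ?_⟩
  · rcases lt_trichotomy p q with h | h | h
    · exact absurd hpq (hlt q p h)
    · exact h
    · exact absurd hpq.symm (hlt p q h)
  · rw [heq p]
    exact hF p _

/-- A directed set whose cardinality equals its true cardinality splits into as many
disjoint cofinal subsets, presented here as the fibres of a map. -/
theorem exists_cofinal_fibers {Λ J : Type u} [Preorder Λ] [Nonempty J]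
    (hinf : Cardinal.aleph0 ≤ Cardinal.mk Λ) (htr : trueCard Λ = Cardinal.mk Λ)
    (hJ : Cardinal.mk J ≤ Cardinal.mk Λ) :
    ∃ s : Λ → J, ∀ j, Cofinal (s ⁻¹' {j}) := by
  obtain ⟨h, hinj, hmem⟩ := exists_injective_of_le_mk (P := Λ × J)
    (fun p => {α : Λ | p.1 < α}) (by
      intro p
      calc Cardinal.mk (Λ × J) = Cardinal.mk Λ * Cardinal.mk J := by simp
        _ ≤ Cardinal.mk Λ * Cardinal.mk Λ := mul_le_mul_right hJ _
        _ = trueCard Λ := by rw [Cardinal.mul_eq_self hinf, htr]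
        _ ≤ _ := ciInf_le' (fun ξ : Λ => Cardinal.mk {α : Λ // ξ < α}) p.1)
  have hΛ : Nonempty Λ := Cardinal.mk_ne_zero_iff.mp (Cardinal.aleph0_pos.trans_le hinf).ne'
  refine ⟨fun α => (Function.invFun h α).2, fun j ξ => ⟨h (ξ, j), ?_, (hmem (ξ, j)).le⟩⟩
  simp [Function.leftInverse_invFun hinj (ξ, j)]

/-- A bounded family in `A` converges weak-* along any ultrafilter to an element of `A**`. -/
theorem exists_ultrafilter_limit {𝕜 A Λ : Type*} [RCLike 𝕜] [SeminormedAddCommGroup A]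
    [NormedSpace 𝕜 A] (a : Λ → A) (M : ℝ) (hbdd : ∀ α, ‖a α‖ ≤ M) (U : Ultrafilter Λ) :
    ∃ Φ : (A →L[𝕜] 𝕜) →L[𝕜] 𝕜, (∀ f : A →L[𝕜] 𝕜, ‖Φ f‖ ≤ M * ‖f‖) ∧
      ∀ f : A →L[𝕜] 𝕜, Tendsto (fun α => f (a α)) U (𝓝 (Φ f)) := by
  have hb : ∀ (f : A →L[𝕜] 𝕜) α, f (a α) ∈ Metric.closedBall (0 : 𝕜) (M * ‖f‖) := by
    intro f α
    rw [mem_closedBall_zero_iff, mul_comm]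
    exact f.le_opNorm_of_le (hbdd α)
  have hex : ∀ f : A →L[𝕜] 𝕜, ∃ x ∈ Metric.closedBall (0 : 𝕜) (M * ‖f‖),
      Tendsto (fun α => f (a α)) U (𝓝 x) := fun f =>
    (isCompact_closedBall (0 : 𝕜) (M * ‖f‖)).ultrafilter_le_nhds
      (U.map fun α => f (a α)) (by
        rw [le_principal_iff]
        exact Filter.Eventually.of_forall (f := (U : Filter Λ)) (hb f))
  choose φ hφ hlim using hex
  let L : (A →L[𝕜] 𝕜) →ₗ[𝕜] 𝕜 :=
    { toFun := φ
      map_add' := fun f g => tendsto_nhds_unique (hlim (f + g)) ((hlim f).add (hlim g))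
      map_smul' := fun c f => tendsto_nhds_unique (hlim (c • f)) ((hlim f).const_smul c) }
  have hL : ∀ f, ‖L f‖ ≤ M * ‖f‖ := fun f => mem_closedBall_zero_iff.mp (hφ f)
  exact ⟨L.mkContinuous M hL, hL, hlim⟩

/-- Any bounded assignment of values on an `ℓ¹`-base extends to a bounded functional. -/
theorem IsL1Base.exists_functional {𝕜 E Λ : Type u} [RCLike 𝕜] [NormedAddCommGroup E]
    [NormedSpace 𝕜 E] {η : Cardinal.{u}} {K : ℝ} {a : Λ → E}
    (ha : Function.Injective a) (hbase : IsL1Base 𝕜 η K (Set.range a))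
    (c : Λ → 𝕜) (C : ℝ) (hc : ∀ α, ‖c α‖ ≤ C) :
    ∃ f : E →L[𝕜] 𝕜, ∀ α, f (a α) = c α := by
  have hbound : ∀ z : Λ →₀ 𝕜,
      (z.sum fun _ w => ‖w‖) ≤ K * ‖Finsupp.linearCombination 𝕜 a z‖ := by
    intro z
    let e := z.support.equivFin.symm
    have h := hbase.2.2 z.support.card (fun n => z (e n)) (fun n => a (e n))
      (fun m n hmn => e.injective (Subtype.ext (ha hmn))) (fun n => ⟨_, rfl⟩)
    rw [Equiv.sum_comp e (fun α => ‖z α‖), Equiv.sum_comp e (fun α => z α • a α),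
      Finset.sum_coe_sort z.support (fun α => ‖z α‖),
      Finset.sum_coe_sort z.support (fun α => z α • a α)] at h
    exact h
  have hli : LinearIndependent 𝕜 a := by
    rw [linearIndependent_iff]
    intro z hz
    have h := hbound z
    rw [hz, norm_zero, mul_zero] at h
    ext α
    by_contra hα
    have h1 : ‖z α‖ ≤ z.sum fun _ w => ‖w‖ :=
      Finset.single_le_sum (f := fun α => ‖z α‖) (fun _ _ => norm_nonneg _)
        (Finsupp.mem_support_iff.mpr hα)
    exact hα (norm_le_zero_iff.mp (h1.trans h))
  let L : ↥(Submodule.span 𝕜 (Set.range a)) →ₗ[𝕜] 𝕜 :=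
    (Finsupp.linearCombination 𝕜 c).comp hli.repr
  have hL : ∀ x, ‖L x‖ ≤ |C| * K * ‖x‖ := by
    intro x
    have h1 : ‖L x‖ ≤ |C| * ((hli.repr x).sum fun _ w => ‖w‖) := by
      change ‖Finsupp.linearCombination 𝕜 c (hli.repr x)‖ ≤ _
      rw [Finsupp.linearCombination_apply, Finsupp.sum, Finsupp.sum, Finset.mul_sum]
      refine norm_sum_le_of_le _ fun α _ => ?_
      rw [norm_smul, mul_comm]
      exact mul_le_mul_of_nonneg_right ((hc α).trans (le_abs_self C)) (norm_nonneg _)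
    have h2 := hbound (hli.repr x)
    rw [hli.linearCombination_repr] at h2
    calc ‖L x‖ ≤ _ := h1
      _ ≤ |C| * (K * ‖(x : E)‖) := mul_le_mul_of_nonneg_left h2 (abs_nonneg C)
      _ = |C| * K * ‖x‖ := by rw [mul_assoc]; rfl
  obtain ⟨g, hg, -⟩ := exists_extension_norm_eq _ (L.mkContinuous _ hL)
  refine ⟨g, fun α => ?_⟩
  have hx : a α ∈ Submodule.span 𝕜 (Set.range a) := Submodule.subset_span ⟨α, rfl⟩
  have h1 := hg ⟨a α, hx⟩
  have h2 : hli.repr ⟨a α, hx⟩ = Finsupp.single α 1 := hli.repr_eq_single α _ rfl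
  rw [h1, LinearMap.mkContinuous_apply]
  change Finsupp.linearCombination 𝕜 c (hli.repr ⟨a α, hx⟩) = c α
  rw [h2, Finsupp.linearCombination_single, one_smul]

section BoundedApproximateIdentity

variable {𝕜 A Λ : Type u} [RCLike 𝕜] [NonUnitalNormedRing A] [NormedSpace 𝕜 A]
  [IsScalarTower 𝕜 A A] [SMulCommClass 𝕜 A A] {a : Λ → A} {M : ℝ}

/-- A weakly almost periodic functional has the same limit along any two ultrafilters for which
`a` is a left, respectively a right, approximate identity. -/
theorem IsWAP.limit_eq (hbdd : ∀ α, ‖a α‖ ≤ M) {U V : Ultrafilter Λ}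
    (hU : ∀ b, Tendsto (fun α => a α * b) U (𝓝 b))
    (hV : ∀ b, Tendsto (fun α => b * a α) V (𝓝 b))
    {Φ Ψ : (A →L[𝕜] 𝕜) →L[𝕜] 𝕜}
    (hΦ : ∀ f : A →L[𝕜] 𝕜, Tendsto (fun α => f (a α)) U (𝓝 (Φ f)))
    (hΨ : ∀ f : A →L[𝕜] 𝕜, Tendsto (fun α => f (a α)) V (𝓝 (Ψ f)))
    {f : A →L[𝕜] 𝕜} (hf : IsWAP 𝕜 A f) : Φ f = Ψ f := by
  obtain ⟨c, hc, hcM⟩ : ∃ c : 𝕜, c ≠ 0 ∧ ∀ α, ‖c • a α‖ ≤ 1 := by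
    have hpos : 0 < max M 1 := lt_max_of_lt_right one_pos
    refine ⟨((max M 1)⁻¹ : ℝ), by exact_mod_cast (inv_pos.mpr hpos).ne', fun α => ?_⟩
    rw [norm_smul, RCLike.norm_ofReal, abs_of_pos (inv_pos.mpr hpos), inv_mul_le_one₀ hpos]
    exact (hbdd α).trans (le_max_left _ _)
  let G : Λ → WeakSpace 𝕜 (A →L[𝕜] 𝕜) := fun α =>
    toWeakSpace 𝕜 (A →L[𝕜] 𝕜) (lAct 𝕜 A f (c • a α))
  obtain ⟨g, -, hg⟩ := IsCompact.ultrafilter_le_nhds hf (U.map G) (by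
    rw [le_principal_iff]
    exact Filter.Eventually.of_forall (f := (U : Filter Λ)) fun α =>
      subset_closure ⟨_, ⟨c • a α, hcM α, rfl⟩, rfl⟩)
  have hweak : ∀ Θ : (A →L[𝕜] 𝕜) →L[𝕜] 𝕜,
      Tendsto (fun α => Θ (lAct 𝕜 A f (c • a α))) U
        (𝓝 (Θ ((toWeakSpace 𝕜 (A →L[𝕜] 𝕜)).symm g))) := fun Θ =>
    ((WeakBilin.eval_continuous (topDualPairing 𝕜 (A →L[𝕜] 𝕜)).flip Θ).tendsto g).comp hg
  have hlim : (toWeakSpace 𝕜 (A →L[𝕜] 𝕜)).symm g = c • f := by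
    ext b
    refine tendsto_nhds_unique (hweak (ContinuousLinearMap.apply 𝕜 𝕜 b)) ?_
    have h := ((f.continuous.tendsto b).comp (hU b)).const_smul c
    refine h.congr fun α => ?_
    simp [lAct]
  have hΨact : ∀ α, Ψ (lAct 𝕜 A f (c • a α)) = c • f (a α) := by
    intro α
    refine tendsto_nhds_unique (hΨ _) ?_
    have h := ((f.continuous.tendsto _).comp (hV (a α))).const_smul c
    refine h.congr fun β => ?_
    simp [lAct]
  have h1 := hweak Ψ
  simp only [hlim, hΨact, map_smul] at h1
  have h2 := tendsto_nhds_unique h1 ((hΦ f).const_smul c)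
  exact (smul_right_injective 𝕜 hc h2).symm

/-- If an injectively indexed bounded approximate identity is an `ℓ¹`-base and its index set
splits into disjoint cofinal sets indexed by `Option ι`, then `A*/W(A)` maps onto `ℓ∞(ι)`. -/
theorem exists_surjective_quotient_WAP [Preorder Λ] [Nonempty Λ] [IsDirected Λ (· ≤ ·)]
    {ι : Type u} {s : Λ → Option ι} (hs : ∀ j, Cofinal (s ⁻¹' {j}))
    (ha : Function.Injective a) (hbdd : ∀ α, ‖a α‖ ≤ M)
    (hleft : ∀ b, Tendsto (fun α => a α * b) atTop (𝓝 b))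
    (hright : ∀ b, Tendsto (fun α => b * a α) atTop (𝓝 b))
    {η : Cardinal.{u}} {K : ℝ} (hbase : IsL1Base 𝕜 η K (Set.range a)) :
    ∃ T : ((A →L[𝕜] 𝕜) ⧸ WAP 𝕜 A) →L[𝕜] lp (fun _ : ι => 𝕜) ∞, Function.Surjective T := by
  have hU : ∀ j, ∃ U : Ultrafilter Λ, (U : Filter Λ) ≤ atTop ∧ ∀ᶠ α in U, s α = j := by
    intro j
    have hne : (atTop ⊓ 𝓟 (s ⁻¹' {j}) : Filter Λ).NeBot := by
      rw [inf_principal_neBot_iff]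
      intro W hW
      obtain ⟨ξ, hξ⟩ := mem_atTop_sets.mp hW
      obtain ⟨α, hα, hξα⟩ := hs j ξ
      exact ⟨α, hξ α hξα, hα⟩
    refine ⟨Ultrafilter.of (atTop ⊓ 𝓟 (s ⁻¹' {j})), (Ultrafilter.of_le _).trans inf_le_left, ?_⟩
    exact (Ultrafilter.of_le _).trans inf_le_right (mem_principal_self _)
  choose U hUtop hUs using hU
  have hM : 0 ≤ M := (norm_nonneg _).trans (hbdd (Classical.arbitrary Λ))
  choose Φ hΦb hΦ using fun j => exists_ultrafilter_limit (𝕜 := 𝕜) a M hbdd (U j)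
  have hdiff : ∀ (f : A →L[𝕜] 𝕜) (i : ι), ‖Φ (some i) f - Φ none f‖ ≤ 2 * M * ‖f‖ := by
    intro f i
    have := norm_sub_le (Φ (some i) f) (Φ none f)
    have := hΦb (some i) f
    have := hΦb none f
    linarith
  let L : (A →L[𝕜] 𝕜) →ₗ[𝕜] lp (fun _ : ι => 𝕜) ∞ :=
    { toFun := fun f => ⟨fun i => Φ (some i) f - Φ none f,
        memℓp_infty ⟨2 * M * ‖f‖, by rintro _ ⟨i, rfl⟩; exact hdiff f i⟩⟩
      map_add' := fun f g => by
        ext i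
        simp only [map_add, lp.coeFn_add, Pi.add_apply]
        ring
      map_smul' := fun c f => by
        ext i
        simp only [map_smul, lp.coeFn_smul, Pi.smul_apply, RingHom.id_apply, smul_sub] }
  let T : (A →L[𝕜] 𝕜) →L[𝕜] lp (fun _ : ι => 𝕜) ∞ := L.mkContinuous (2 * M) fun f =>
    lp.norm_le_of_forall_le (by positivity) (hdiff f)
  have hker : WAP 𝕜 A ≤ T.ker := by
    refine Submodule.topologicalClosure_minimal _ (Submodule.span_le.mpr fun f hf => ?_)
      T.isClosed_ker
    refine LinearMap.mem_ker.mpr (lp.ext (funext fun i => ?_))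
    exact sub_eq_zero.mpr (IsWAP.limit_eq hbdd (fun b => (hleft b).mono_left (hUtop _))
      (fun b => (hright b).mono_left (hUtop _)) (hΦ _) (hΦ _) hf)
  refine ⟨(WAP 𝕜 A).liftQL T hker, fun y => ?_⟩
  obtain ⟨f, hf⟩ := hbase.exists_functional ha
    (fun α => (s α).elim 0 y) ‖y‖ (fun α => by
      cases s α with
      | none => simp
      | some i => exact lp.norm_apply_le_norm ENNReal.top_ne_zero y i)
  have hval : ∀ j : Option ι, Φ j f = j.elim 0 y := fun j =>
    tendsto_nhds_unique (hΦ j f) (tendsto_const_nhds.congr' ((hUs j).mono fun α hα => by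
      simp only [hf, hα]))
  refine ⟨Submodule.Quotient.mk f, lp.ext (funext fun i => ?_)⟩
  change Φ (some i) f - Φ none f = y i
  simp [hval]

end BoundedApproximateIdentity

/-- The dual of a normed space of density character at most `#ι` embeds isometrically
in `ℓ∞(ι)`. -/
theorem exists_isometry_dual_lp (𝕜 : Type u) {E ι : Type u} [RCLike 𝕜] [NormedAddCommGroup E]
    [NormedSpace 𝕜 E] (hd : densityChar E ≤ Cardinal.mk ι) :
    ∃ J : (E →L[𝕜] 𝕜) →L[𝕜] lp (fun _ : ι => 𝕜) ∞, Isometry J := by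
  have : Nonempty {s : Set E // Dense s} := ⟨⟨Set.univ, dense_univ⟩⟩
  obtain ⟨⟨D, hD⟩, hDcard⟩ := ciInf_mem fun s : {s : Set E // Dense s} => Cardinal.mk ↥(s.1)
  have hDι : Cardinal.mk ↥D ≤ Cardinal.mk ι := hDcard.le.trans hd
  have : Nonempty ↥D := hD.nonempty.to_subtype
  obtain ⟨e⟩ := Cardinal.le_def _ _ |>.mp hDι
  obtain ⟨p, hp⟩ : ∃ p : ι → ↥D, Function.Surjective p :=
    ⟨Function.invFun e, Function.invFun_surjective e.injective⟩
  have hb : ∀ (f : E →L[𝕜] 𝕜) (i : ι), ‖(‖(p i : E)‖⁻¹ : 𝕜) * f (p i)‖ ≤ ‖f‖ := by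
    intro f i
    rw [norm_mul, norm_inv, RCLike.norm_coe_norm]
    by_cases h0 : ‖(p i : E)‖ = 0
    · simp [h0]
    · rw [inv_mul_le_iff₀ (lt_of_le_of_ne (norm_nonneg _) (Ne.symm h0)), mul_comm]
      exact f.le_opNorm _
  let L : (E →L[𝕜] 𝕜) →ₗ[𝕜] lp (fun _ : ι => 𝕜) ∞ :=
    { toFun := fun f => ⟨fun i => (‖(p i : E)‖⁻¹ : 𝕜) * f (p i),
        memℓp_infty ⟨‖f‖, by rintro _ ⟨i, rfl⟩; exact hb f i⟩⟩
      map_add' := fun f g => by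
        ext i
        simp only [add_apply, lp.coeFn_add, Pi.add_apply]
        ring
      map_smul' := fun c f => by
        ext i
        simp only [smul_apply, lp.coeFn_smul, Pi.smul_apply,
          RingHom.id_apply, smul_eq_mul]
        ring }
  have hL : ∀ f, ‖L f‖ ≤ 1 * ‖f‖ := fun f => by
    rw [one_mul]
    exact lp.norm_le_of_forall_le (norm_nonneg f) (hb f)
  refine ⟨L.mkContinuous 1 hL, AddMonoidHomClass.isometry_of_norm _ fun f =>
    le_antisymm ((hL f).trans_eq (one_mul _)) ?_⟩
  refine f.opNorm_le_bound (norm_nonneg _) fun x => ?_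
  refine hD.induction (P := fun x => ‖f x‖ ≤ ‖L f‖ * ‖x‖) ?_
    (isClosed_le (by fun_prop) (by fun_prop)) x
  intro x hx
  obtain ⟨i, hi⟩ := hp ⟨x, hx⟩
  have h1 : ‖(‖(p i : E)‖⁻¹ : 𝕜) * f (p i)‖ ≤ ‖L f‖ :=
    lp.norm_apply_le_norm ENNReal.top_ne_zero (L f) i
  rw [hi, norm_mul, norm_inv, RCLike.norm_coe_norm] at h1
  by_cases h0 : x = 0
  · simp [h0]
  · rwa [inv_mul_le_iff₀ (norm_pos_iff.mpr h0), mul_comm] at h1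

/-- If `E` maps onto a space which contains the complete space `F` isometrically, then a closed
subspace of `E` maps onto `F`. -/
theorem exists_closed_submodule_surjective {𝕜 E F G : Type*} [RCLike 𝕜]
    [AddCommGroup E] [Module 𝕜 E] [TopologicalSpace E]
    [NormedAddCommGroup F] [NormedSpace 𝕜 F] [CompleteSpace F]
    [NormedAddCommGroup G] [NormedSpace 𝕜 G]
    (T : E →L[𝕜] G) (hT : Function.Surjective T) (J : F →L[𝕜] G) (hJ : Isometry J) :
    ∃ S : Submodule 𝕜 E, IsClosed (S : Set E) ∧
      ∃ R : ↥S →L[𝕜] F, Function.Surjective R := by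
  let J' : F →ₗᵢ[𝕜] G := ⟨J.toLinearMap, fun x => hJ.norm_map_of_map_zero (map_zero J) x⟩
  have hS : ∀ x : ↥(Submodule.comap T.toLinearMap (LinearMap.range J.toLinearMap)),
      T x ∈ LinearMap.range J'.toLinearMap := fun x => x.2
  refine ⟨Submodule.comap T.toLinearMap (LinearMap.range J.toLinearMap),
    hJ.isClosedEmbedding.isClosed_range.preimage T.continuous,
    (J'.equivRange.symm.toContinuousLinearEquiv : _ →L[𝕜] F).comp
      ((T.comp (Submodule.subtypeL _)).codRestrict _ hS), fun f => ?_⟩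
  obtain ⟨x, hx⟩ := hT (J f)
  refine ⟨⟨x, f, hx.symm⟩, ?_⟩
  change J'.equivRange.symm _ = f
  rw [LinearIsometryEquiv.symm_apply_eq]
  exact Subtype.ext hx

/-- if a Banach algebra `A` contains a bounded approximate identity,
indexed injectively by a directed set of true cardinality `η`, which is an `ℓ¹(η)`-base,
then (i) there is a bounded linear surjection of `A*/W(A)` onto `ℓ∞(η)`; (ii) in particular
`A` is not Arens regular; and (iii) if `d(A) ≤ η` then `A` is extremely non-Arens regular. -/
theorem statement6 (𝕜 A : Type u) [RCLike 𝕜] [NonUnitalNormedRing A] [NormedSpace 𝕜 A]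
    [IsScalarTower 𝕜 A A] [SMulCommClass 𝕜 A A] [CompleteSpace A]
    (η : Cardinal.{u}) (hη : Cardinal.aleph0 ≤ η)
    (ι : Type u) (hι : Cardinal.mk ι = η)
    (Λ : Type u) [Preorder Λ] [Nonempty Λ] [IsDirected Λ (· ≤ ·)]
    (htr : trueCard Λ = η)
    (a : Λ → A) (hainj : Function.Injective a)
    -- `{a_α}` is a bounded approximate identity
    (M : ℝ) (hbdd : ∀ α, ‖a α‖ ≤ M)
    (hbai : ∀ b : A,
      Filter.Tendsto (fun α => ‖b * a α - b‖) Filter.atTop (nhds 0) ∧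
      Filter.Tendsto (fun α => ‖a α * b - b‖) Filter.atTop (nhds 0))
    -- which is an `ℓ¹(η)`-base
    (K : ℝ) (hK : 0 < K) (hbase : IsL1Base 𝕜 η K (Set.range a)) :
    (∃ T : ((A →L[𝕜] 𝕜) ⧸ WAP 𝕜 A) →L[𝕜] lp (fun _ : ι => 𝕜) ∞, Function.Surjective T) ∧
    WAP 𝕜 A ≠ ⊤ ∧
    (densityChar A ≤ η → ExtremelyNonArensRegular 𝕜 A) := by
  have hΛ : Cardinal.mk Λ = η := (Cardinal.mk_range_eq a hainj).symm.trans hbase.1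
  have hopt : Cardinal.mk (Option ι) ≤ Cardinal.mk Λ := by
    rw [Cardinal.mk_option, hι, hΛ, Cardinal.add_one_eq hη]
  obtain ⟨s, hs⟩ := exists_cofinal_fibers (J := Option ι) (hη.trans hΛ.ge)
    (htr.trans hΛ.symm) hopt
  obtain ⟨T, hT⟩ := exists_surjective_quotient_WAP hs hainj hbdd
    (fun b => tendsto_iff_norm_sub_tendsto_zero.mpr (hbai b).2)
    (fun b => tendsto_iff_norm_sub_tendsto_zero.mpr (hbai b).1) hbase
  refine ⟨⟨T, hT⟩, fun htop => ?_, fun hd => ?_⟩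
  · have hne : Nonempty ι :=
      Cardinal.mk_ne_zero_iff.mp (hι ▸ (Cardinal.aleph0_pos.trans_le hη).ne')
    have hsub : Subsingleton ((A →L[𝕜] 𝕜) ⧸ WAP 𝕜 A) :=
      Submodule.Quotient.subsingleton_iff.2 htop
    have hsub' := hT.subsingleton
    let x : lp (fun _ : ι => 𝕜) ∞ :=
      ⟨fun _ => 1, memℓp_infty ⟨1, by rintro _ ⟨i, rfl⟩; simp⟩⟩
    have hx : x = 0 := Subsingleton.elim _ _
    have h1 : x hne.some = 0 := by rw [hx]; rfl
    exact one_ne_zero (α := 𝕜) h1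
  · obtain ⟨J, hJ⟩ := exists_isometry_dual_lp 𝕜 (E := A) (ι := ι) (hd.trans hι.ge)
    exact exists_closed_submodule_surjective T hT J hJ

end Paper
end
end

section
/- Let A be an infinite-dimensional Banach algebra possessing a bounded approximate identity, and let S be a separable closed subspace of A. Then A contains a separable closed subalgebra B containing S which has a sequential bounded approximate identity. If, moreover, A has no identity element, then B can be chosen to have no identity element. -/
open Filter Topology
open scoped ENNReal

noncomputable section

universe u

namespace Paper

/-- A (non-unital) normed algebra possesses a bounded approximate identity when there is a
bounded net `(e_α)` over some directed preorder with `lim_α ‖b e_α − b‖ = lim_α ‖e_α b − b‖ = 0`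
for every `b`. -/
def HasBAI (A : Type u) [NonUnitalNormedRing A] : Prop :=
  ∃ (Λ : Type u) (le : Λ → Λ → Prop) (e : Λ → A) (M : ℝ),
    Nonempty Λ ∧
    (∀ α, le α α) ∧ (∀ ⦃x y z⦄, le x y → le y z → le x z) ∧
    (∀ x y : Λ, ∃ z, le x z ∧ le y z) ∧
    (∀ α, ‖e α‖ ≤ M) ∧
    ∀ (b : A) (ε : ℝ), 0 < ε → ∃ α₀, ∀ α, le α₀ α →
      ‖b * e α - b‖ < ε ∧ ‖e α * b - b‖ < ε

section Subalgebra

variable {𝕜 A : Type*} [RCLike 𝕜] [NonUnitalNormedRing A] [NormedSpace 𝕜 A]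
    [IsScalarTower 𝕜 A A] [SMulCommClass 𝕜 A A]

/-- The elements on which the sequence `z` acts asymptotically as a two-sided identity. -/
def asymptoticallyFixed (𝕜 : Type*) {A : Type*} [RCLike 𝕜] [NonUnitalNormedRing A]
    [NormedSpace 𝕜 A] [IsScalarTower 𝕜 A A] [SMulCommClass 𝕜 A A] (z : ℕ → A) :
    NonUnitalSubalgebra 𝕜 A where
  carrier := {b | Tendsto (fun n => b * z n) atTop (𝓝 b) ∧ Tendsto (fun n => z n * b) atTop (𝓝 b)}
  add_mem' := by
    rintro a b ⟨ha, ha'⟩ ⟨hb, hb'⟩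
    exact ⟨by simpa only [add_mul] using ha.add hb, by simpa only [mul_add] using ha'.add hb'⟩
  zero_mem' := by simp
  mul_mem' := by
    rintro a b ⟨ha, ha'⟩ ⟨hb, hb'⟩
    exact ⟨by simpa only [mul_assoc] using hb.const_mul a,
      by simpa only [mul_assoc] using ha'.mul_const b⟩
  smul_mem' := by
    rintro c b ⟨hb, hb'⟩
    exact ⟨by simpa only [smul_mul_assoc] using hb.const_smul c,
      by simpa only [mul_smul_comm] using hb'.const_smul c⟩

lemma mem_asymptoticallyFixed {z : ℕ → A} {b : A} :
    b ∈ asymptoticallyFixed 𝕜 z ↔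
      Tendsto (fun n => b * z n) atTop (𝓝 b) ∧ Tendsto (fun n => z n * b) atTop (𝓝 b) :=
  Iff.rfl

/-- Uniformly Lipschitz maps that converge to the identity pointwise on a set do so on
its closure. -/
lemma tendsto_of_mem_closure {E : Type*} [SeminormedAddCommGroup E] {T : ℕ → E → E} {M : ℝ}
    (hT : ∀ n a b, ‖T n a - T n b‖ ≤ M * ‖a - b‖) {s : Set E}
    (hs : ∀ b ∈ s, Tendsto (fun n => T n b) atTop (𝓝 b)) {b : E} (hb : b ∈ closure s) :
    Tendsto (fun n => T n b) atTop (𝓝 b) := by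
  rw [Metric.tendsto_nhds]
  intro ε hε
  have hM : 0 < |M| + 1 := by positivity
  obtain ⟨c, hc, hbc⟩ := Metric.mem_closure_iff.1 hb (ε / 2 / (|M| + 1)) (by positivity)
  filter_upwards [Metric.tendsto_nhds.1 (hs c hc) (ε / 2) (by positivity)] with n hn
  rw [lt_div_iff₀ hM, dist_eq_norm] at hbc
  have h₁ : dist (T n b) (T n c) ≤ |M| * ‖b - c‖ := by
    rw [dist_eq_norm]
    exact (hT n b c).trans (by gcongr; exact le_abs_self M)
  have h₂ : dist c b = ‖b - c‖ := by rw [dist_comm, dist_eq_norm]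
  have := dist_triangle4 (T n b) (T n c) c b
  linarith

lemma isClosed_asymptoticallyFixed {z : ℕ → A} {M : ℝ} (hz : ∀ n, ‖z n‖ ≤ M) :
    IsClosed (asymptoticallyFixed 𝕜 z : Set A) := by
  refine isClosed_of_closure_subset fun b hb => mem_asymptoticallyFixed.2 ⟨?_, ?_⟩
  · refine tendsto_of_mem_closure (T := fun n b => b * z n) (M := M) (fun n a b => ?_)
      (fun b hb => (mem_asymptoticallyFixed.1 hb).1) hb
    rw [← sub_mul, mul_comm M]
    exact (norm_mul_le _ _).trans (by gcongr; exact hz n)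
  · refine tendsto_of_mem_closure (T := fun n b => z n * b) (M := M) (fun n a b => ?_)
      (fun b hb => (mem_asymptoticallyFixed.1 hb).2) hb
    rw [← mul_sub]
    exact (norm_mul_le _ _).trans (by gcongr; exact hz n)

lemma countable_subsemigroup_closure {G : Type*} [Semigroup G] {s : Set G} (hs : s.Countable) :
    (Subsemigroup.closure s : Set G).Countable := by
  have := hs.to_subtype
  have : Countable (FreeSemigroup s) := by
    refine Function.Injective.countable (f := fun w : FreeSemigroup s => (w.head, w.tail)) ?_
    rintro ⟨a, l⟩ ⟨b, m⟩ h
    simpa using h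
  refine (Set.countable_range (FreeSemigroup.lift ((↑) : s → G))).mono ?_
  change Subsemigroup.closure s ≤ (FreeSemigroup.lift ((↑) : s → G)).srange
  exact Subsemigroup.closure_le.2 fun a ha => ⟨FreeSemigroup.of ⟨a, ha⟩, by simp⟩

lemma isSeparable_adjoin {s : Set A} (hs : s.Countable) :
    TopologicalSpace.IsSeparable (NonUnitalAlgebra.adjoin 𝕜 s : Set A) := by
  have h : (NonUnitalAlgebra.adjoin 𝕜 s : Set A) =
      (Submodule.span 𝕜 (Subsemigroup.closure s : Set A) : Set A) := by
    rw [← NonUnitalAlgebra.adjoin_eq_span]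
    rfl
  rw [h]
  exact (countable_subsemigroup_closure hs).isSeparable.span

end Subalgebra

section ApproximateIdentity

variable {A : Type*} [NonUnitalNormedRing A]

lemma HasBAI.exists_filter (h : HasBAI A) :
    ∃ (L : Filter A) (M : ℝ), L.NeBot ∧ (∀ᶠ z in L, ‖z‖ ≤ M) ∧
      ∀ b : A, Tendsto (fun z => b * z) L (𝓝 b) ∧ Tendsto (fun z => z * b) L (𝓝 b) := by
  obtain ⟨Λ, le, e, M, hne, hrefl, htrans, hdir, hM, hlim⟩ := h
  let _ : Preorder Λ :=
    { le := le, le_refl := hrefl, le_trans := fun _ _ _ h h' => htrans h h' }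
  have : IsDirectedOrder Λ := ⟨hdir⟩
  refine ⟨map e atTop, M, inferInstance, eventually_map.2 (.of_forall hM), fun b => ?_⟩
  simp only [Metric.tendsto_nhds, eventually_map, dist_eq_norm]
  constructor <;> intro ε hε <;> obtain ⟨α, hα⟩ := hlim b ε hε
  · filter_upwards [eventually_ge_atTop α] with β hβ using (hα β hβ).1
  · filter_upwards [eventually_ge_atTop α] with β hβ using (hα β hβ).2

/-- An approximate identity of a complete algebra without identity is not Cauchy. -/
lemma exists_separation [CompleteSpace A] {L : Filter A} [L.NeBot]
    (hL : ∀ b : A, Tendsto (fun z => b * z) L (𝓝 b) ∧ Tendsto (fun z => z * b) L (𝓝 b)) :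
    ∃ ε : ℝ, ((¬ ∃ u : A, ∀ b : A, u * b = b ∧ b * u = b) → 0 < ε) ∧
      ∀ t ∈ L, ∃ x ∈ t, ∃ y ∈ t, ε ≤ dist x y := by
  by_cases hu : ∃ u : A, ∀ b : A, u * b = b ∧ b * u = b
  · refine ⟨0, fun h => absurd hu h, fun t ht => ?_⟩
    obtain ⟨x, hx⟩ := Filter.nonempty_of_mem ht
    exact ⟨x, hx, x, hx, dist_nonneg⟩
  · have hC : ¬ Cauchy L := by
      intro hC
      obtain ⟨u, hLu⟩ := CompleteSpace.complete hC
      refine hu ⟨u, fun b => ⟨?_, ?_⟩⟩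
      · exact tendsto_nhds_unique ((tendsto_id.mono_left hLu).mul_const b) (hL b).2
      · exact tendsto_nhds_unique ((tendsto_id.mono_left hLu).const_mul b) (hL b).1
    rw [Metric.cauchy_iff] at hC
    push Not at hC
    obtain ⟨ε, hε, h⟩ := hC inferInstance
    exact ⟨ε, fun _ => hε, h⟩

/-- Two interlocking sequences extracted from an approximate identity, each of which is an
approximate identity for a given sequence and for both extracted sequences. -/
lemma exists_interlocking_seq {L : Filter A} {M ε : ℝ}
    (hM : ∀ᶠ z in L, ‖z‖ ≤ M)
    (hL : ∀ b : A, Tendsto (fun z => b * z) L (𝓝 b) ∧ Tendsto (fun z => z * b) L (𝓝 b))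
    (hε : ∀ t ∈ L, ∃ x ∈ t, ∃ y ∈ t, ε ≤ dist x y) (d : ℕ → A) :
    ∃ x y : ℕ → A, (∀ n, ‖x n‖ ≤ M ∧ ‖y n‖ ≤ M ∧ ε ≤ dist (x n) (y n)) ∧
      ∀ b ∈ Set.range d ∪ Set.range x ∪ Set.range y, ∀ z, z = x ∨ z = y →
        Tendsto (fun n => b * z n) atTop (𝓝 b) ∧ Tendsto (fun n => z n * b) atTop (𝓝 b) := by
  let near : ℕ → A → A → Prop := fun k b z =>
    dist (b * z) b < 1 / ((k : ℝ) + 1) ∧ dist (z * b) b < 1 / ((k : ℝ) + 1)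
  have near_mem (k : ℕ) (b : A) : ∀ᶠ z in L, near k b z :=
    (Metric.tendsto_nhds.1 (hL b).1 _ Nat.one_div_pos_of_nat).and
      (Metric.tendsto_nhds.1 (hL b).2 _ Nat.one_div_pos_of_nat)
  obtain ⟨f, hf, hf'⟩ := exists_seq_of_forall_finset_exists (α := ℕ × A × A)
    (fun p => (‖p.2.1‖ ≤ M ∧ ‖p.2.2‖ ≤ M ∧ ε ≤ dist p.2.1 p.2.2) ∧
      ∀ i ≤ p.1, near p.1 (d i) p.2.1 ∧ near p.1 (d i) p.2.2)
    (fun p q => p.1 < q.1 ∧ (near q.1 p.2.1 q.2.1 ∧ near q.1 p.2.1 q.2.2) ∧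
      near q.1 p.2.2 q.2.1 ∧ near q.1 p.2.2 q.2.2) (by
    intro s _
    let k := s.sup Prod.fst + 1
    have h₁ : ∀ᶠ z in L, ∀ i ∈ Finset.range (k + 1), near k (d i) z :=
      (Finset.eventually_all _).2 fun i _ => near_mem k (d i)
    have h₂ : ∀ᶠ z in L, ∀ p ∈ s, near k p.2.1 z ∧ near k p.2.2 z :=
      (Finset.eventually_all _).2 fun p _ => (near_mem k p.2.1).and (near_mem k p.2.2)
    obtain ⟨x, ⟨hxM, hx₁, hx₂⟩, y, ⟨hyM, hy₁, hy₂⟩, hxy⟩ := hε _ (hM.and (h₁.and h₂))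
    refine ⟨(k, x, y), ⟨⟨hxM, hyM, hxy⟩, fun i hi => ?_⟩, fun p hp => ⟨?_, ?_⟩⟩
    · have hi' : i ∈ Finset.range (k + 1) := Finset.mem_range.2 (Nat.lt_succ_of_le hi)
      exact ⟨hx₁ i hi', hy₁ i hi'⟩
    · exact Nat.lt_succ_of_le (Finset.le_sup (f := Prod.fst) hp)
    · exact ⟨⟨(hx₂ p hp).1, (hy₂ p hp).1⟩, (hx₂ p hp).2, (hy₂ p hp).2⟩)
  have hmono : StrictMono fun n => (f n).1 := fun m n h => (hf' m n h).1
  have key (b : A) (z : ℕ → A) (N : ℕ) (h : ∀ n, N < n → near (f n).1 b (z n)) :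
      Tendsto (fun n => b * z n) atTop (𝓝 b) ∧ Tendsto (fun n => z n * b) atTop (𝓝 b) := by
    have h0 : Tendsto (fun n => 1 / (((f n).1 : ℝ) + 1)) atTop (𝓝 0) :=
      tendsto_one_div_add_atTop_nhds_zero_nat.comp hmono.tendsto_atTop
    constructor <;> rw [tendsto_iff_dist_tendsto_zero] <;>
      refine squeeze_zero' (.of_forall fun _ => dist_nonneg) ?_ h0 <;>
      filter_upwards [eventually_gt_atTop N] with n hn
    · exact (h n hn).1.le
    · exact (h n hn).2.le
  refine ⟨fun n => (f n).2.1, fun n => (f n).2.2, fun n => (hf n).1, ?_⟩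
  rintro b ((⟨m, rfl⟩ | ⟨m, rfl⟩) | ⟨m, rfl⟩) z (rfl | rfl) <;>
    refine key _ _ m fun n hn => ?_
  · exact ((hf n).2 m (hn.le.trans hmono.le_apply)).1
  · exact ((hf n).2 m (hn.le.trans hmono.le_apply)).2
  · exact (hf' m n hn).2.1.1
  · exact (hf' m n hn).2.1.2
  · exact (hf' m n hn).2.2.1
  · exact (hf' m n hn).2.2.2

end ApproximateIdentity

/-- an infinite-dimensional Banach algebra with a bounded approximate
identity contains, around any separable closed subspace `S`, a separable closed subalgebra
`B ⊇ S` with a sequential bounded approximate identity; moreover if `A` has no identity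
element then `B` can be chosen without an identity element. -/
theorem statement7 (𝕜 A : Type u) [RCLike 𝕜] [NonUnitalNormedRing A] [NormedSpace 𝕜 A]
    [IsScalarTower 𝕜 A A] [SMulCommClass 𝕜 A A] [CompleteSpace A]
    (hinf : ¬ FiniteDimensional 𝕜 A)
    (hbai : HasBAI A)
    (S : Submodule 𝕜 A) (hSclosed : IsClosed (S : Set A))
    (hSsep : TopologicalSpace.IsSeparable (S : Set A)) :
    ∃ B : NonUnitalSubalgebra 𝕜 A,
      IsClosed (B : Set A) ∧
      TopologicalSpace.IsSeparable (B : Set A) ∧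
      (S : Set A) ⊆ (B : Set A) ∧
      (∃ (e : ℕ → A) (M : ℝ), (∀ n, e n ∈ B) ∧ (∀ n, ‖e n‖ ≤ M) ∧
        ∀ b ∈ B, Tendsto (fun n => ‖b * e n - b‖) atTop (𝓝 0) ∧
                 Tendsto (fun n => ‖e n * b - b‖) atTop (𝓝 0)) ∧
      ((¬ ∃ u : A, ∀ b : A, u * b = b ∧ b * u = b) →
        ¬ ∃ u ∈ B, ∀ b ∈ B, u * b = b ∧ b * u = b) := by
  obtain ⟨L, M, hLne, hM, hL⟩ := hbai.exists_filter
  obtain ⟨ε, hεpos, hε⟩ := exists_separation hL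
  obtain ⟨D, hDc, hSD⟩ := hSsep
  obtain ⟨d, hd⟩ := (hDc.insert 0).exists_eq_range (Set.insert_nonempty 0 D)
  obtain ⟨x, y, hxy, hlim⟩ := exists_interlocking_seq hM hL hε d
  set G := Set.range d ∪ Set.range x ∪ Set.range y
  have hGc : G.Countable :=
    ((Set.countable_range d).union (Set.countable_range x)).union (Set.countable_range y)
  let B := (NonUnitalAlgebra.adjoin 𝕜 G).topologicalClosure
  have hGB : G ⊆ B := (NonUnitalAlgebra.subset_adjoin 𝕜).trans
    (NonUnitalSubalgebra.le_topologicalClosure _)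
  have hBclosed : IsClosed (B : Set A) := NonUnitalSubalgebra.isClosed_topologicalClosure _
  have hfix (z : ℕ → A) (hz : z = x ∨ z = y) (hzM : ∀ n, ‖z n‖ ≤ M) :
      B ≤ asymptoticallyFixed 𝕜 z :=
    NonUnitalSubalgebra.topologicalClosure_minimal
      (NonUnitalAlgebra.adjoin_le fun b hb => mem_asymptoticallyFixed.2 (hlim b hb z hz))
      (isClosed_asymptoticallyFixed hzM)
  have hx := hfix x (.inl rfl) fun n => (hxy n).1
  have hy := hfix y (.inr rfl) fun n => (hxy n).2.1
  have hxB (n : ℕ) : x n ∈ B := hGB (.inl (.inr ⟨n, rfl⟩))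
  have hyB (n : ℕ) : y n ∈ B := hGB (.inr ⟨n, rfl⟩)
  refine ⟨B, hBclosed, (isSeparable_adjoin hGc).closure, ?_,
    ⟨x, M, hxB, fun n => (hxy n).1, fun b hb => ?_⟩, ?_⟩
  · refine hSD.trans (closure_minimal (fun a ha => hGB (.inl (.inl ?_))) hBclosed)
    exact hd ▸ Set.mem_insert_of_mem 0 ha
  · obtain ⟨h, h'⟩ := mem_asymptoticallyFixed.1 (hx hb)
    exact ⟨tendsto_iff_norm_sub_tendsto_zero.1 h, tendsto_iff_norm_sub_tendsto_zero.1 h'⟩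
  · rintro hno ⟨u, huB, hu⟩
    have hxu : Tendsto x atTop (𝓝 u) := by
      simpa only [(hu _ (hxB _)).1] using (mem_asymptoticallyFixed.1 (hx huB)).1
    have hyu : Tendsto y atTop (𝓝 u) := by
      simpa only [(hu _ (hyB _)).1] using (mem_asymptoticallyFixed.1 (hy huB)).1
    have h0 := ge_of_tendsto (hxu.dist hyu) (.of_forall fun n => (hxy n).2.2)
    rw [dist_self] at h0
    exact (hεpos hno).not_ge h0

end Paper
end
end

section
/- Let A be a Banach algebra containing a closed subalgebra B which has no identity element, is weakly sequentially complete, and possesses a bounded approximate identity. Then: (i) there is a bounded linear surjection from the quotient space A*/W(A) onto ℓ∞ = ℓ∞(ℕ); (ii) in particular, A is not Arens regular; (iii) if A is in addition separable, then A is extremely non-Arens regular. -/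
open Filter Topology
open scoped ENNReal

noncomputable section

universe u

namespace Paper

/-- Every infinite set of natural numbers contains a diagonal sequence whose tails satisfy a
hereditary property that can always be achieved by shrinking. -/
theorem exists_strictMono_diagonal (R : ℕ → ℕ → Set ℕ → Prop)
    (hR : ∀ k n S T, R k n S → T ⊆ S → R k n T) {M : Set ℕ} (hM : M.Infinite)
    (h : ∀ k, ∀ n ∈ M, ∀ S ⊆ M, S.Infinite → ∃ T ⊆ S, T.Infinite ∧ R k n T) :
    ∃ φ : ℕ → ℕ, StrictMono φ ∧ (∀ k, φ k ∈ M) ∧ ∀ k, R k (φ k) (φ '' Set.Ioi k) := by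
  have step : ∀ (k : ℕ) (S : {S : Set ℕ // S ⊆ M ∧ S.Infinite}),
      ∃ p : ℕ × {S : Set ℕ // S ⊆ M ∧ S.Infinite},
        p.1 ∈ S.1 ∧ p.2.1 ⊆ S.1 ∩ Set.Ioi p.1 ∧ R k p.1 p.2.1 := by
    rintro k ⟨S, hSM, hS⟩
    obtain ⟨n, hn⟩ := hS.nonempty
    have hinf : (S ∩ Set.Ioi n).Infinite := by
      refine (hS.sdiff (Set.finite_Iic n)).mono ?_
      rintro m ⟨h1, h2⟩
      exact ⟨h1, by simpa using h2⟩
    obtain ⟨T, hT, hTi, hRT⟩ := h k n (hSM hn) _ (Set.inter_subset_left.trans hSM) hinf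
    exact ⟨(n, ⟨T, hT.trans (Set.inter_subset_left.trans hSM), hTi⟩), hn, hT, hRT⟩
  choose next h1 h2 h3 using step
  let S : ℕ → {S : Set ℕ // S ⊆ M ∧ S.Infinite} :=
    Nat.rec ⟨M, subset_rfl, hM⟩ fun k S => (next k S).2
  let φ : ℕ → ℕ := fun k => (next k (S k)).1
  have hSsucc : ∀ k, (S (k + 1)).1 ⊆ (S k).1 ∩ Set.Ioi (φ k) := fun k => h2 k (S k)
  have hanti : Antitone fun k => (S k).1 :=
    antitone_nat_of_succ_le fun k => (hSsucc k).trans Set.inter_subset_left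
  have hmem : ∀ k, φ k ∈ (S k).1 := fun k => h1 k (S k)
  refine ⟨φ, strictMono_nat_of_lt_succ fun k => (hSsucc k (hmem (k + 1))).2,
    fun k => (S k).2.1 (hmem k), fun k => hR _ _ _ _ (h3 k (S k)) ?_⟩
  rintro _ ⟨j, hj, rfl⟩
  exact hanti (Nat.succ_le_of_lt hj) (hmem j)

/-- `f` oscillates along `S` when it belongs to infinitely many of the sets `C b n`, `n ∈ S`, for
both values of `b`. -/
def Oscillates {K : Type*} (C : Bool → ℕ → Set K) (f : K) (S : Set ℕ) : Prop :=
  ∀ b, {n ∈ S | f ∈ C b n}.Infinite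

theorem Oscillates.mono {K : Type*} {C : Bool → ℕ → Set K} {f : K} {S T : Set ℕ}
    (h : Oscillates C f S) (hST : S ⊆ T) : Oscillates C f T :=
  fun b => (h b).mono fun _ hn => ⟨hST hn.1, hn.2⟩

/-- The points lying in `C (t n) n` for all `n ∈ s`. -/
def cell {K : Type*} (C : Bool → ℕ → Set K) (s : Finset ℕ) (t : ℕ → Bool) : Set K :=
  {f | ∀ n ∈ s, f ∈ C (t n) n}

/-- Along some infinite set, all cells over `s` contain points oscillating along any given
infinite subset. -/
def OscillatingCells {K : Type*} (C : Bool → ℕ → Set K) (s : Finset ℕ) : Prop :=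
  ∃ M : Set ℕ, M.Infinite ∧ ∀ t, ∀ S ⊆ M, S.Infinite → ∃ f ∈ cell C s t, Oscillates C f S

theorem OscillatingCells.exists_insert {K : Type*} {C : Bool → ℕ → Set K} {s : Finset ℕ}
    (h : OscillatingCells C s) (N : ℕ) : ∃ n > N, OscillatingCells C (insert n s) := by
  by_contra! hcon
  obtain ⟨M, hM, hosc⟩ := h
  have hM' : (M \ Set.Iic N).Infinite := hM.sdiff (Set.finite_Iic N)
  obtain ⟨φ, hφ, hφM, hφR⟩ := exists_strictMono_diagonal
    (fun _ n S => ∃ t, ∀ f ∈ cell C (insert n s) t, ¬ Oscillates C f S)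
    (by
      rintro _ n S T ⟨t, ht⟩ hTS
      exact ⟨t, fun f hf hT => ht f hf (hT.mono hTS)⟩) hM'
    (by
      intro _ n hn S _ hS
      have := hcon n (by simpa using hn.2)
      simp only [OscillatingCells] at this
      push Not at this
      obtain ⟨t, T, hT, hTi, hf⟩ := this S hS
      exact ⟨T, hT, hTi, t, hf⟩)
  choose t ht using hφR
  obtain ⟨⟨p, b⟩, hfib⟩ :=
    Finite.exists_infinite_fiber fun k => ((fun i : s => t k i, t k (φ k)) : (s → Bool) × Bool)
  rw [Set.infinite_coe_iff] at hfib
  obtain ⟨k₀, hk₀⟩ := hfib.nonempty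
  obtain ⟨f, hf, hfo⟩ := hosc (t k₀) (φ '' _)
    (by rintro _ ⟨k, -, rfl⟩; exact (hφM k).1) (hfib.image hφ.injective.injOn)
  obtain ⟨_, ⟨k, hk, rfl⟩, hfk⟩ := (hfo b).nonempty
  simp only [Set.mem_preimage, Set.mem_singleton_iff, Prod.mk.injEq] at hk hk₀
  refine ht k f ?_ fun b' => ?_
  · intro n hn
    rcases Finset.mem_insert.1 hn with rfl | hn
    · rw [hk.2]; exact hfk
    · have h1 := congrFun hk.1 ⟨n, hn⟩
      have h2 := congrFun hk₀.1 ⟨n, hn⟩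
      simp only at h1 h2
      rw [h1, ← h2]
      exact hf n hn
  · refine ((hfo b').sdiff ((Set.finite_Iic k).image φ)).mono ?_
    rintro _ ⟨⟨⟨j, -, rfl⟩, hj⟩, hjk⟩
    refine ⟨⟨j, ?_, rfl⟩, hj⟩
    by_contra hle
    exact hjk ⟨j, by simpa using hle, rfl⟩

/-- Rosenthal's combinatorial dichotomy: if every infinite set of indices admits an oscillating
point, then some subsequence of the pairs `(C true n, C false n)` is independent. -/
theorem exists_independent_subsequence {K : Type*} {C : Bool → ℕ → Set K} {M : Set ℕ}
    (hM : M.Infinite) (h : ∀ S ⊆ M, S.Infinite → ∃ f, Oscillates C f S) :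
    ∃ φ : ℕ → ℕ, StrictMono φ ∧
      ∀ (s : Finset ℕ) (t : ℕ → Bool), ∃ f, ∀ i ∈ s, f ∈ C (t i) (φ i) := by
  have h0 : OscillatingCells C ∅ :=
    ⟨M, hM, fun t S hSM hS => (h S hSM hS).imp fun f hf => ⟨by simp [cell], hf⟩⟩
  have step : ∀ p : ℕ × {s // OscillatingCells C s},
      ∃ n > p.1, OscillatingCells C (insert n p.2.1) := fun p => p.2.2.exists_insert p.1
  choose next h1 h2 using step
  let S : ℕ → ℕ × {s // OscillatingCells C s} :=
    Nat.rec (0, ⟨∅, h0⟩) fun _ p => (next p, ⟨insert (next p) p.2.1, h2 p⟩)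
  let φ : ℕ → ℕ := fun k => (S (k + 1)).1
  have hφ : StrictMono φ := strictMono_nat_of_lt_succ fun k => h1 (S (k + 1))
  have hmono : Monotone fun k => (S k).2.1 :=
    monotone_nat_of_le_succ fun k => Finset.subset_insert (next (S k)) (S k).2.1
  refine ⟨φ, hφ, fun s t => ?_⟩
  obtain ⟨N, hN⟩ := s.bddAbove
  obtain ⟨M', hM', hosc⟩ := (S (N + 1)).2.2
  obtain ⟨f, hf, -⟩ := hosc (fun n => t (Function.invFun φ n)) M' subset_rfl hM'
  refine ⟨f, fun i hi => ?_⟩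
  have hmem : φ i ∈ (S (N + 1)).2.1 :=
    hmono (Nat.succ_le_succ (hN hi)) (Finset.mem_insert_self (next (S i)) (S i).2.1)
  have := hf (φ i) hmem
  beta_reduce at this
  rwa [Function.leftInverse_invFun hφ.injective i] at this

variable {𝕜 : Type*} [RCLike 𝕜]

section Rosenthal

variable {E : Type*} [NormedAddCommGroup E] [NormedSpace 𝕜 E]

/-- The functionals in the unit ball whose value at `x n` is close to `w b`, relative to the
distance between `w true` and `w false`. -/
def nearValue (x : ℕ → E) (w : Bool → 𝕜) (b : Bool) (n : ℕ) :
    Set {f : E →L[𝕜] 𝕜 // ‖f‖ ≤ 1} :=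
  {f | ‖f.1 (x n) - w b‖ < ‖w true - w false‖ / 8}

theorem lower_l1_bound_of_independent {x : ℕ → E} {w : Bool → 𝕜}
    (h : ∀ (s : Finset ℕ) (t : ℕ → Bool), ∃ f, ∀ i ∈ s, f ∈ nearValue x w (t i) i)
    (s : Finset ℕ) (c : ℕ → 𝕜) :
    ‖w true - w false‖ / 8 * ∑ i ∈ s, ‖c i‖ ≤ ‖∑ i ∈ s, c i • x i‖ := by
  set D := w true - w false with hD
  have key : ∀ t : ℕ → Bool, ‖D‖ * ‖∑ i ∈ s, c i * (if t i then 1 else -1)‖ ≤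
      2 * ‖∑ i ∈ s, c i • x i‖ + ‖D‖ / 4 * ∑ i ∈ s, ‖c i‖ := by
    intro t
    obtain ⟨⟨f, hf⟩, hft⟩ := h s t
    obtain ⟨⟨g, hg⟩, hgt⟩ := h s (fun i => !t i)
    have hfg : ‖f - g‖ ≤ 2 := (norm_sub_le _ _).trans (by linarith)
    have herr : ∀ i ∈ s, ‖(f - g) (x i) - D * (if t i then 1 else -1)‖ ≤ ‖D‖ / 4 := by
      intro i hi
      have h1 : ‖f (x i) - w (t i)‖ < ‖D‖ / 8 := hft i hi
      have h2 : ‖g (x i) - w (!t i)‖ < ‖D‖ / 8 := hgt i hi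
      have h3 : (f - g) (x i) - D * (if t i then 1 else -1) =
          (f (x i) - w (t i)) - (g (x i) - w (!t i)) := by
        cases t i <;> simp [hD] <;> ring
      rw [h3]
      exact (norm_sub_le _ _).trans (by linarith)
    have hsplit : D * ∑ i ∈ s, c i * (if t i then 1 else -1) = (f - g) (∑ i ∈ s, c i • x i) -
        ∑ i ∈ s, c i * ((f - g) (x i) - D * (if t i then 1 else -1)) := by
      rw [map_sum, ← Finset.sum_sub_distrib, Finset.mul_sum]
      refine Finset.sum_congr rfl fun i _ => ?_
      rw [map_smul, smul_eq_mul]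
      ring
    rw [← norm_mul, hsplit]
    refine (norm_sub_le _ _).trans (add_le_add ?_ ?_)
    · exact ((f - g).le_opNorm _).trans (by gcongr)
    · rw [Finset.mul_sum]
      refine norm_sum_le_of_le _ fun i hi => ?_
      rw [norm_mul, mul_comm]
      exact mul_le_mul_of_nonneg_right (herr i hi) (norm_nonneg _)
  have hsum : ∀ p : 𝕜 →+ ℝ, (∀ z, |p z| ≤ ‖z‖) → ‖D‖ * ∑ i ∈ s, |p (c i)| ≤
      2 * ‖∑ i ∈ s, c i • x i‖ + ‖D‖ / 4 * ∑ i ∈ s, ‖c i‖ := by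
    intro p hp
    refine le_trans ?_ (key fun i => decide (0 ≤ p (c i)))
    refine mul_le_mul_of_nonneg_left ?_ (norm_nonneg _)
    refine le_trans (le_trans (le_of_eq ?_) (le_abs_self _)) (hp _)
    rw [map_sum]
    refine Finset.sum_congr rfl fun i _ => ?_
    by_cases h0 : 0 ≤ p (c i)
    · simp [h0, abs_of_nonneg]
    · simp [h0, abs_of_neg (not_le.1 h0)]
  have hre := hsum (RCLike.re : 𝕜 →+ ℝ) RCLike.abs_re_le_norm
  have him := hsum (RCLike.im : 𝕜 →+ ℝ) RCLike.abs_im_le_norm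
  have hle : ∑ i ∈ s, ‖c i‖ ≤
      ∑ i ∈ s, |RCLike.re (c i)| + ∑ i ∈ s, |RCLike.im (c i)| := by
    rw [← Finset.sum_add_distrib]
    refine Finset.sum_le_sum fun i _ => ?_
    have h1 := norm_add_le (RCLike.re (c i) : 𝕜) (RCLike.im (c i) * RCLike.I)
    rw [RCLike.re_add_im, norm_mul, RCLike.norm_ofReal, RCLike.norm_ofReal] at h1
    refine h1.trans (add_le_add le_rfl (mul_le_of_le_one_right (abs_nonneg _) ?_))
    rw [RCLike.norm_I]
    split_ifs <;> norm_num
  have := mul_le_mul_of_nonneg_left hle (norm_nonneg D)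
  linarith

/-- A bounded sequence has a weakly Cauchy subsequence if, for every pair of distinct scalars, each
infinite index set can be shrunk so that no functional oscillates between the two scalars. -/
theorem exists_weaklyCauchy_subsequence {x : ℕ → E} {M : ℝ} (hM : ∀ n, ‖x n‖ ≤ M)
    (h : ∀ w : Bool → 𝕜, w true ≠ w false → ∀ S : Set ℕ, S.Infinite →
      ∃ T ⊆ S, T.Infinite ∧ ∀ f, ¬ Oscillates (nearValue x w) f T) :
    ∃ φ : ℕ → ℕ, StrictMono φ ∧
      ∀ f : E →L[𝕜] 𝕜, ∃ l, Tendsto (fun n => f (x (φ n))) atTop (𝓝 l) := by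
  let u := TopologicalSpace.denseSeq (Bool → 𝕜)
  obtain ⟨φ, hφ, -, hR⟩ := exists_strictMono_diagonal
    (fun k _ S => u k true ≠ u k false → ∀ f, ¬ Oscillates (nearValue x (u k)) f S)
    (fun k _ S T hS hTS hu f hT => hS hu f (hT.mono hTS)) Set.infinite_univ
    (by
      intro k _ _ S _ hS
      by_cases hu : u k true = u k false
      · exact ⟨S, subset_rfl, hS, fun h' => (h' hu).elim⟩
      · obtain ⟨T, hT, hTi, hf⟩ := h (u k) hu S hS
        exact ⟨T, hT, hTi, fun _ => hf⟩)
  refine ⟨φ, hφ, ?_⟩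
  have hball : ∀ f : E →L[𝕜] 𝕜, ‖f‖ ≤ 1 →
      ∃ l, Tendsto (fun n => f (x (φ n))) atTop (𝓝 l) := by
    intro f hf
    have hcomp := isCompact_closedBall (0 : 𝕜) M
    have hmem : ∀ᶠ n in atTop, f (x (φ n)) ∈ Metric.closedBall (0 : 𝕜) M := by
      refine .of_forall fun n => mem_closedBall_zero_iff.2 ?_
      refine (f.le_opNorm _).trans ((mul_le_of_le_one_left (norm_nonneg _) hf).trans (hM _))
    obtain ⟨a, -, ha⟩ := hcomp.exists_mapClusterPt (le_principal_iff.2 hmem)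
    refine ⟨a, hcomp.tendsto_nhds_of_unique_mapClusterPt hmem fun b _ hb => ?_⟩
    by_contra hne
    let U : Set (Bool → 𝕜) := {p | ∀ i, ‖(bif i then b else a) - p i‖ < ‖p true - p false‖ / 8}
    have hU : IsOpen U := by
      have : U = ⋂ i, {p | ‖(bif i then b else a) - p i‖ < ‖p true - p false‖ / 8} := by
        ext p; simp [U]
      rw [this]
      exact isOpen_iInter_of_finite fun i => isOpen_lt (by fun_prop) (by fun_prop)
    have hUn : U.Nonempty := by
      refine ⟨fun i => bif i then b else a, fun i => ?_⟩
      have : 0 < ‖b - a‖ := norm_pos_iff.2 (sub_ne_zero.2 hne)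
      simp only [sub_self, norm_zero, cond_true, cond_false]
      positivity
    obtain ⟨k, hk⟩ :=
      (TopologicalSpace.denseRange_denseSeq (Bool → 𝕜)).exists_mem_open hU hUn
    have hu : u k true ≠ u k false := by
      intro heq
      have h1 := (norm_nonneg _).trans_lt (hk true)
      have h2 : TopologicalSpace.denseSeq (Bool → 𝕜) k true -
        TopologicalSpace.denseSeq (Bool → 𝕜) k false = 0 := sub_eq_zero.2 heq
      simp [h2] at h1
    refine hR k hu ⟨f, hf⟩ fun i => ?_
    have hcl : MapClusterPt (bif i then b else a) atTop fun n => f (x (φ n)) := by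
      cases i
      exacts [ha, hb]
    have hopen : IsOpen {y : 𝕜 | ‖y - u k i‖ < ‖u k true - u k false‖ / 8} :=
      isOpen_lt (by fun_prop) (by fun_prop)
    have hfreq := (mapClusterPt_iff_frequently.1 hcl _ (hopen.mem_nhds (hk i))).and_eventually
      (eventually_gt_atTop k)
    refine ((Nat.frequently_atTop_iff_infinite.1 hfreq).image hφ.injective.injOn).mono ?_
    rintro _ ⟨j, ⟨hj, hkj⟩, rfl⟩
    exact ⟨⟨j, hkj, rfl⟩, hj⟩
  intro f
  obtain ⟨l, hl⟩ := hball (((‖f‖ + 1 : ℝ) : 𝕜)⁻¹ • f) (by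
    rw [norm_smul, norm_inv, RCLike.norm_ofReal, abs_of_pos (by positivity)]
    exact inv_mul_le_one_of_le₀ (by linarith) (by positivity))
  refine ⟨((‖f‖ + 1 : ℝ) : 𝕜) * l, (hl.const_mul ((‖f‖ + 1 : ℝ) : 𝕜)).congr fun n => ?_⟩
  have : ((‖f‖ + 1 : ℝ) : 𝕜) ≠ 0 := RCLike.ofReal_ne_zero.2 (by positivity)
  simp only [smul_apply, smul_eq_mul]
  exact mul_inv_cancel_left₀ this _

/-- **Rosenthal's `ℓ¹` theorem**: a bounded sequence without weakly Cauchy subsequences has a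
subsequence equivalent to the unit vector basis of `ℓ¹`. -/
theorem exists_l1_subsequence {x : ℕ → E} {M : ℝ} (hM : ∀ n, ‖x n‖ ≤ M)
    (h : ¬ ∃ φ : ℕ → ℕ, StrictMono φ ∧
      ∀ f : E →L[𝕜] 𝕜, ∃ l, Tendsto (fun n => f (x (φ n))) atTop (𝓝 l)) :
    ∃ φ : ℕ → ℕ, StrictMono φ ∧ ∃ δ > 0, ∀ (s : Finset ℕ) (c : ℕ → 𝕜),
      δ * ∑ i ∈ s, ‖c i‖ ≤ ‖∑ i ∈ s, c i • x (φ i)‖ := by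
  have hosc : ∃ w : Bool → 𝕜, w true ≠ w false ∧ ∃ S : Set ℕ, S.Infinite ∧
      ∀ T ⊆ S, T.Infinite → ∃ f, Oscillates (nearValue x w) f T := by
    by_contra! hcon
    exact h (exists_weaklyCauchy_subsequence hM hcon)
  obtain ⟨w, hw, S, hS, hT⟩ := hosc
  obtain ⟨φ, hφ, hind⟩ := exists_independent_subsequence hS hT
  refine ⟨φ, hφ, ‖w true - w false‖ / 8, ?_, lower_l1_bound_of_independent hind⟩
  have : 0 < ‖w true - w false‖ := norm_pos_iff.2 (sub_ne_zero.2 hw)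
  positivity

/-- On a sequence satisfying a lower `ℓ¹` estimate, functionals take arbitrary bounded values. -/
theorem exists_functional_of_l1 {x : ℕ → E} {δ : ℝ} (hδ : 0 < δ)
    (hx : ∀ (s : Finset ℕ) (c : ℕ → 𝕜), δ * ∑ i ∈ s, ‖c i‖ ≤ ‖∑ i ∈ s, c i • x i‖)
    {a : ℕ → 𝕜} {R : ℝ} (ha : ∀ n, ‖a n‖ ≤ R) : ∃ f : E →L[𝕜] 𝕜, ∀ n, f (x n) = a n := by
  let L : (ℕ →₀ 𝕜) →ₗ[𝕜] E := Finsupp.linearCombination 𝕜 x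
  have hL : ∀ z : ℕ →₀ 𝕜, δ * ∑ i ∈ z.support, ‖z i‖ ≤ ‖L z‖ := fun z => hx z.support z
  have hinj : Function.Injective L := by
    rw [injective_iff_map_eq_zero]
    intro z hz
    have h1 := hL z
    rw [hz, norm_zero] at h1
    have h2 : ∑ i ∈ z.support, ‖z i‖ ≤ 0 := by
      by_contra! hpos
      exact absurd h1 (not_le.2 (mul_pos hδ hpos))
    have h3 := (Finset.sum_eq_zero_iff_of_nonneg fun i _ => norm_nonneg (z i)).1
      (h2.antisymm (Finset.sum_nonneg fun i _ => norm_nonneg (z i)))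
    ext i
    by_cases hi : i ∈ z.support
    · exact norm_eq_zero.1 (h3 i hi)
    · simpa using hi
  let e := LinearEquiv.ofInjective L hinj
  have hR : 0 ≤ R := (norm_nonneg _).trans (ha 0)
  have hbound : ∀ y : L.range,
      ‖(Finsupp.linearCombination 𝕜 a ∘ₗ e.symm.toLinearMap) y‖ ≤ R / δ * ‖y‖ := by
    intro y
    obtain ⟨z, rfl⟩ := e.surjective y
    have h1 : ‖L z‖ = ‖e z‖ := rfl
    have h2 : ‖Finsupp.linearCombination 𝕜 a z‖ ≤ R * ∑ i ∈ z.support, ‖z i‖ := by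
      rw [Finsupp.linearCombination_apply, Finsupp.sum, Finset.mul_sum]
      refine norm_sum_le_of_le _ fun i _ => ?_
      rw [norm_smul, mul_comm]
      exact mul_le_mul_of_nonneg_right (ha i) (norm_nonneg _)
    simp only [LinearMap.comp_apply, LinearEquiv.coe_coe, LinearEquiv.symm_apply_apply]
    refine h2.trans ?_
    rw [← h1, div_mul_eq_mul_div, mul_div_assoc]
    refine mul_le_mul_of_nonneg_left ?_ hR
    rw [le_div_iff₀ hδ, mul_comm]
    exact hL z
  obtain ⟨f, hf, -⟩ := exists_extension_norm_eq L.range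
    ((Finsupp.linearCombination 𝕜 a ∘ₗ e.symm.toLinearMap).mkContinuous _ hbound)
  refine ⟨f, fun n => ?_⟩
  have h1 : x n = (e (Finsupp.single n 1) : E) := by
    change x n = L (Finsupp.single n 1)
    simp [L]
  rw [h1, hf]
  simp

end Rosenthal

section UltraLimit

variable {E : Type*} [NormedAddCommGroup E] [NormedSpace 𝕜 E]

/-- A bounded sequence converges along an ultrafilter to an element of the bidual. -/
theorem exists_bidual_limit_s8 (U : Ultrafilter ℕ) {x : ℕ → E} {M : ℝ} (hM : ∀ n, ‖x n‖ ≤ M) :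
    ∃ F : (E →L[𝕜] 𝕜) →L[𝕜] 𝕜, ‖F‖ ≤ M ∧ ∀ f, Tendsto (fun n => f (x n)) U (𝓝 (F f)) := by
  let j : ℕ → WeakDual 𝕜 (E →L[𝕜] 𝕜) := fun n =>
    WeakDual.toStrongDual.symm (NormedSpace.inclusionInDoubleDual 𝕜 E (x n))
  obtain ⟨F, hF, hlim⟩ := (WeakDual.isCompact_closedBall (𝕜 := 𝕜) (E := E →L[𝕜] 𝕜) 0 M)
    |>.ultrafilter_le_nhds (U.map j) (by
      refine le_principal_iff.2 (mem_map.2 (univ_mem' fun n => ?_))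
      have : ‖NormedSpace.inclusionInDoubleDual 𝕜 E (x n)‖ ≤ M :=
        (NormedSpace.double_dual_bound 𝕜 E (x n)).trans (hM n)
      simpa [j] using this)
  refine ⟨WeakDual.toStrongDual F, by simpa using hF, fun f => ?_⟩
  have hjlim : Tendsto j U (𝓝 F) := hlim
  exact ((WeakDual.eval_continuous f).tendsto F).comp hjlim

/-- Functionals on a separable normed space embed isometrically into `ℓ∞`. -/
theorem exists_dual_linearIsometry_lp [TopologicalSpace.SeparableSpace E] :
    Nonempty ((E →L[𝕜] 𝕜) →ₗᵢ[𝕜] lp (fun _ : ℕ => 𝕜) ∞) := by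
  let B := Metric.closedBall (0 : E) 1
  have : Nonempty B := ⟨⟨0, by simp [B]⟩⟩
  let d : ℕ → B := TopologicalSpace.denseSeq B
  have hd : ∀ n, ‖(d n : E)‖ ≤ 1 := fun n => mem_closedBall_zero_iff.1 (d n).2
  have hbd : ∀ (f : E →L[𝕜] 𝕜) n, ‖f (d n)‖ ≤ ‖f‖ := fun f n =>
    (f.le_opNorm _).trans (mul_le_of_le_one_right (norm_nonneg _) (hd n))
  let T : (E →L[𝕜] 𝕜) →ₗ[𝕜] lp (fun _ : ℕ => 𝕜) ∞ :=
    { toFun := fun f => ⟨fun n => f (d n),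
        memℓp_infty ⟨‖f‖, by rintro _ ⟨n, rfl⟩; exact hbd f n⟩⟩
      map_add' := fun f g => rfl
      map_smul' := fun c f => rfl }
  refine ⟨⟨T, fun f => le_antisymm (lp.norm_le_of_forall_le (norm_nonneg _) (hbd f)) ?_⟩⟩
  have hball : ∀ y : B, ‖f y‖ ≤ ‖T f‖ := by
    intro y
    have hcl : IsClosed {y : B | ‖f y‖ ≤ ‖T f‖} := isClosed_le (by fun_prop) (by fun_prop)
    have hsub : Set.range d ⊆ {y : B | ‖f y‖ ≤ ‖T f‖} := by
      rintro _ ⟨n, rfl⟩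
      exact lp.norm_apply_le_norm (by simp) (T f) n
    exact hcl.closure_subset_iff.2 hsub (TopologicalSpace.denseRange_denseSeq B y)
  exact ContinuousLinearMap.opNorm_le_of_unit_norm (norm_nonneg _) fun y hy =>
    hball ⟨y, mem_closedBall_zero_iff.2 hy.le⟩

end UltraLimit

section WeaklyAlmostPeriodic

variable {𝕜 A : Type u} [RCLike 𝕜] [NonUnitalNormedRing A] [NormedSpace 𝕜 A]
  [IsScalarTower 𝕜 A A] [SMulCommClass 𝕜 A A]

/-- A weakly almost periodic functional takes the same ultralimit along two bounded sequences
each of which acts on the other as an approximate identity in the appropriate order. -/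
theorem IsWAP.bidual_limit_eq {f : A →L[𝕜] 𝕜} (hf : IsWAP 𝕜 A f) (U : Ultrafilter ℕ)
    {x y : ℕ → A} {M : ℝ} (hx : ∀ n, ‖x n‖ ≤ M)
    (hxy : ∀ n, Tendsto (fun m => x n * y m) U (𝓝 (x n)))
    (hyx : ∀ m, Tendsto (fun n => x n * y m) U (𝓝 (y m)))
    {F G : (A →L[𝕜] 𝕜) →L[𝕜] 𝕜} (hF : ∀ f, Tendsto (fun n => f (x n)) U (𝓝 (F f)))
    (hG : ∀ f, Tendsto (fun n => f (y n)) U (𝓝 (G f))) : F f = G f := by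
  set r : 𝕜 := ((|M| + 1 : ℝ) : 𝕜) with hr
  have hr0 : r ≠ 0 := RCLike.ofReal_ne_zero.2 (by positivity)
  have hmem : ∀ n, ‖r⁻¹ • x n‖ ≤ 1 := by
    intro n
    rw [norm_smul, norm_inv, hr, RCLike.norm_ofReal, abs_of_pos (by positivity)]
    exact inv_mul_le_one_of_le₀ ((hx n).trans (by linarith [le_abs_self M])) (by positivity)
  obtain ⟨g, -, hg⟩ := hf.ultrafilter_le_nhds
    (U.map fun n => toWeakSpace 𝕜 (A →L[𝕜] 𝕜) (lAct 𝕜 A f (r⁻¹ • x n)))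
    (le_principal_iff.2 (mem_map.2 (univ_mem' fun n =>
      subset_closure ⟨_, ⟨_, hmem n, rfl⟩, rfl⟩)))
  let g' : A →L[𝕜] 𝕜 := (toWeakSpace 𝕜 (A →L[𝕜] 𝕜)).symm g
  have hlim : ∀ H : (A →L[𝕜] 𝕜) →L[𝕜] 𝕜,
      Tendsto (fun n => H (lAct 𝕜 A f (r⁻¹ • x n))) U (𝓝 (H g')) := fun H =>
    ((WeakBilin.eval_continuous (topDualPairing 𝕜 (A →L[𝕜] 𝕜)).flip H).tendsto g).comp hg
  have happ : ∀ n a, lAct 𝕜 A f (r⁻¹ • x n) a = r⁻¹ * f (x n * a) := by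
    intro n a
    simp [lAct]
  have hg' : ∀ m, g' (y m) = r⁻¹ * f (y m) := by
    intro m
    refine tendsto_nhds_unique (hlim (ContinuousLinearMap.apply 𝕜 𝕜 (y m))) ?_
    simp only [ContinuousLinearMap.apply_apply, happ]
    exact ((f.continuous.tendsto _).comp (hyx m)).const_mul _
  have hGg : G g' = r⁻¹ * G f := by
    refine tendsto_nhds_unique (hG g') ?_
    simp only [hg']
    exact (hG f).const_mul _
  have hGx : ∀ n, G (lAct 𝕜 A f (r⁻¹ • x n)) = r⁻¹ * f (x n) := by
    intro n
    refine tendsto_nhds_unique (hG _) ?_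
    simp only [happ]
    exact ((f.continuous.tendsto _).comp (hxy n)).const_mul _
  have h1 := hlim G
  simp only [hGx, hGg] at h1
  exact mul_left_cancel₀ (inv_ne_zero hr0) (tendsto_nhds_unique ((hF f).const_mul _) h1)

/-- An `ℓ¹`-sequence which is an approximate identity for its own members yields a surjection of
`A*/W(A)` onto `ℓ∞`. -/
theorem exists_surjective_of_l1_approximateUnit {x : ℕ → A} {M : ℝ} (hM : ∀ n, ‖x n‖ ≤ M)
    (hr : ∀ n, Tendsto (fun m => x n * x m) atTop (𝓝 (x n)))
    (hl : ∀ n, Tendsto (fun m => x m * x n) atTop (𝓝 (x n))) {δ : ℝ} (hδ : 0 < δ)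
    (hx : ∀ (s : Finset ℕ) (c : ℕ → 𝕜), δ * ∑ i ∈ s, ‖c i‖ ≤ ‖∑ i ∈ s, c i • x i‖) :
    ∃ T : ((A →L[𝕜] 𝕜) ⧸ WAP 𝕜 A) →L[𝕜] lp (fun _ : ℕ => 𝕜) ∞, Function.Surjective T := by
  let U : Ultrafilter ℕ := hyperfilter ℕ
  have hpair : ∀ k, Tendsto (Nat.pair k) U atTop := fun k =>
    (tendsto_atTop_mono (Nat.right_le_pair k) tendsto_id).mono_left Nat.hyperfilter_le_atTop
  choose F hFM hF using fun k => exists_bidual_limit_s8 (𝕜 := 𝕜) U fun n => hM (Nat.pair k n)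
  have hFx : ∀ {f : A →L[𝕜] 𝕜} (hf : IsWAP 𝕜 A f) k, F k f = F 0 f := fun hf k =>
    hf.bidual_limit_eq U (fun n => hM (Nat.pair k n)) (fun n => (hr _).comp (hpair 0))
      (fun m => (hl _).comp (hpair k)) (hF k) (hF 0)
  have hbd : ∀ (f : A →L[𝕜] 𝕜) k, ‖F (k + 1) f - F 0 f‖ ≤ 2 * M * ‖f‖ := fun f k =>
    calc ‖F (k + 1) f - F 0 f‖ ≤ ‖F (k + 1) f‖ + ‖F 0 f‖ := norm_sub_le _ _
      _ ≤ M * ‖f‖ + M * ‖f‖ := add_le_add ((F _).le_of_opNorm_le (hFM _) f)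
          ((F _).le_of_opNorm_le (hFM _) f)
      _ = 2 * M * ‖f‖ := by ring
  have hM0 : 0 ≤ M := (norm_nonneg _).trans (hM 0)
  let T₀ : (A →L[𝕜] 𝕜) →ₗ[𝕜] lp (fun _ : ℕ => 𝕜) ∞ :=
    { toFun := fun f => ⟨fun k => F (k + 1) f - F 0 f,
        memℓp_infty ⟨2 * M * ‖f‖, by rintro _ ⟨n, rfl⟩; exact hbd f n⟩⟩
      map_add' := fun f g => by
        ext k
        simp only [map_add, lp.coeFn_add, Pi.add_apply]
        ring
      map_smul' := fun c f => by
        ext k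
        simp [mul_sub] }
  let T : (A →L[𝕜] 𝕜) →L[𝕜] lp (fun _ : ℕ => 𝕜) ∞ := T₀.mkContinuous (2 * M) fun f =>
    lp.norm_le_of_forall_le (by positivity) (hbd f)
  have hker : WAP 𝕜 A ≤ T.ker := by
    refine Submodule.topologicalClosure_minimal _ (Submodule.span_le.2 fun f hf => ?_)
      T.isClosed_ker
    change T f = 0
    ext k
    exact sub_eq_zero.2 (hFx hf (k + 1))
  refine ⟨(WAP 𝕜 A).liftQL T hker, fun c => ?_⟩
  obtain ⟨f, hf⟩ := exists_functional_of_l1 hδ hx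
    (a := fun n => if n.unpair.1 = 0 then 0 else c (n.unpair.1 - 1)) (R := ‖c‖) (by
      intro n
      split_ifs
      · simp
      · exact lp.norm_apply_le_norm (by simp) c _)
  refine ⟨Submodule.Quotient.mk f, ?_⟩
  change T f = c
  ext k
  change F (k + 1) f - F 0 f = c k
  have h1 : F (k + 1) f = c k :=
    tendsto_nhds_unique (hF (k + 1) f) (tendsto_const_nhds.congr fun n => by simp [hf])
  have h0 : F 0 f = 0 :=
    tendsto_nhds_unique (hF 0 f) (tendsto_const_nhds.congr fun n => by simp [hf])
  rw [h1, h0, sub_zero]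

end WeaklyAlmostPeriodic

section ApproximateUnit

variable {A : Type*} [NonUnitalNormedRing A]

/-- A bounded approximate identity that does not converge contains a uniformly separated sequence
acting as an approximate identity on its own members. -/
theorem exists_separated_approximateUnit {B : Set A} {Λ : Type*} (U : Ultrafilter Λ) {e : Λ → A}
    (he : ∀ α, e α ∈ B)
    (hr : ∀ b ∈ B, Tendsto (fun α => b * e α) U (𝓝 b))
    (hl : ∀ b ∈ B, Tendsto (fun α => e α * b) U (𝓝 b)) {ε : ℝ}
    (hε : ∀ b, ∀ᶠ α in U, ε ≤ ‖b - e α‖) :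
    ∃ α : ℕ → Λ, (∀ m n, m < n → ε ≤ ‖e (α m) - e (α n)‖) ∧
      (∀ n, Tendsto (fun m => e (α n) * e (α m)) atTop (𝓝 (e (α n)))) ∧
      ∀ n, Tendsto (fun m => e (α m) * e (α n)) atTop (𝓝 (e (α n))) := by
  obtain ⟨p, -, hp⟩ := exists_seq_of_forall_finset_exists (α := ℕ × Λ) (fun _ => True)
    (fun p q => p.1 < q.1 ∧ ε ≤ ‖e p.2 - e q.2‖ ∧
      dist (e p.2 * e q.2) (e p.2) < 1 / ((q.1 : ℝ) + 1) ∧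
      dist (e q.2 * e p.2) (e p.2) < 1 / ((q.1 : ℝ) + 1)) (by
    intro s _
    obtain ⟨N, hN⟩ := (s.image Prod.fst).exists_nat_subset_range
    have hpos : (0 : ℝ) < 1 / ((N : ℝ) + 1) := by positivity
    have hev : ∀ᶠ α in U, ∀ p ∈ s, ε ≤ ‖e p.2 - e α‖ ∧
        dist (e p.2 * e α) (e p.2) < 1 / ((N : ℝ) + 1) ∧
        dist (e α * e p.2) (e p.2) < 1 / ((N : ℝ) + 1) := by
      refine (Finset.eventually_all s).2 fun p _ => (hε _).and (.and ?_ ?_)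
      · exact Metric.tendsto_nhds.1 (hr _ (he _)) _ hpos
      · exact Metric.tendsto_nhds.1 (hl _ (he _)) _ hpos
    obtain ⟨α, hα⟩ := hev.exists
    exact ⟨(N, α), trivial, fun p hps =>
      ⟨Finset.mem_range.1 (hN (Finset.mem_image_of_mem _ hps)), hα p hps⟩⟩)
  have hmono : StrictMono fun n => (p n).1 := fun m n hmn => (hp m n hmn).1
  have hbound : Tendsto (fun m => 1 / (((p m).1 : ℝ) + 1)) atTop (𝓝 0) :=
    tendsto_one_div_add_atTop_nhds_zero_nat.comp hmono.tendsto_atTop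
  refine ⟨fun n => (p n).2, fun m n hmn => (hp m n hmn).2.1, fun n => ?_, fun n => ?_⟩
  · refine tendsto_iff_dist_tendsto_zero.2
      (squeeze_zero' (.of_forall fun _ => dist_nonneg) ?_ hbound)
    filter_upwards [eventually_gt_atTop n] with m hm using (hp n m hm).2.2.1.le
  · refine tendsto_iff_dist_tendsto_zero.2
      (squeeze_zero' (.of_forall fun _ => dist_nonneg) ?_ hbound)
    filter_upwards [eventually_gt_atTop n] with m hm using (hp n m hm).2.2.2.le

variable {𝕜 : Type*} [RCLike 𝕜] [NormedSpace 𝕜 A] [IsScalarTower 𝕜 A A] [SMulCommClass 𝕜 A A]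

/-- If a subsequence of a bounded sequence, acting as an approximate identity on its own members,
converges weakly, then the whole sequence converges in norm. -/
theorem tendsto_of_weakly_convergent_subsequence {x : ℕ → A} {M : ℝ} (hM : ∀ n, ‖x n‖ ≤ M)
    (hr : ∀ n, Tendsto (fun m => x n * x m) atTop (𝓝 (x n)))
    (hl : ∀ n, Tendsto (fun m => x m * x n) atTop (𝓝 (x n))) {φ : ℕ → ℕ} (hφ : StrictMono φ)
    {y : A} (hy : ∀ f : A →L[𝕜] 𝕜, Tendsto (fun n => f (x (φ n))) atTop (𝓝 (f y))) :
    Tendsto x atTop (𝓝 y) := by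
  have hxy : ∀ n, x n * y = x n := by
    intro n
    refine (SeparatingDual.eq_iff_forall_dual_eq (R := 𝕜)).2 fun f => ?_
    refine tendsto_nhds_unique (hy (f.comp (ContinuousLinearMap.mul 𝕜 A (x n)))) ?_
    exact (f.continuous.tendsto _).comp ((hr n).comp hφ.tendsto_atTop)
  let Z : Submodule 𝕜 A := (Submodule.span 𝕜 (Set.range x)).topologicalClosure
  have hZ : IsClosed (Z : Set A) := Submodule.isClosed_topologicalClosure _
  have hyZ : y ∈ Z := by
    by_contra hyZ
    have hne : (Submodule.Quotient.mk y : A ⧸ Z) ≠ 0 := fun h =>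
      hyZ ((Submodule.Quotient.mk_eq_zero Z).1 h)
    obtain ⟨g, hg⟩ := SeparatingDual.exists_ne_zero (R := 𝕜) hne
    refine hg (tendsto_nhds_unique (hy (g.comp Z.mkQL)) ?_)
    refine tendsto_const_nhds.congr fun n => ?_
    have : (Submodule.Quotient.mk (x (φ n)) : A ⧸ Z) = 0 := (Submodule.Quotient.mk_eq_zero Z).2
      (Submodule.le_topologicalClosure _ (Submodule.subset_span ⟨_, rfl⟩))
    change 0 = g (Submodule.Quotient.mk (x (φ n)))
    rw [this, map_zero]
  have hspan : ∀ z ∈ Submodule.span 𝕜 (Set.range x), Tendsto (fun m => x m * z) atTop (𝓝 z) := by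
    intro z hz
    induction hz using Submodule.span_induction with
    | mem z hz => obtain ⟨n, rfl⟩ := hz; exact hl n
    | zero => simp
    | add a b _ _ ha hb => simpa only [mul_add] using ha.add hb
    | smul c a _ ha => simpa only [mul_smul_comm] using ha.const_smul c
  have hyl : Tendsto (fun m => x m * y) atTop (𝓝 y) := by
    have hM0 : 0 ≤ M := (norm_nonneg _).trans (hM 0)
    rw [Metric.tendsto_nhds]
    intro ε hε
    obtain ⟨z, hz, hyz⟩ := Metric.mem_closure_iff.1 hyZ (ε / (2 * (M + 1))) (by positivity)
    filter_upwards [Metric.tendsto_nhds.1 (hspan z hz) (ε / 2) (by positivity)] with m hm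
    rw [dist_eq_norm] at hm hyz ⊢
    rw [lt_div_iff₀ (by positivity)] at hyz
    have h1 : x m * y - y = x m * (y - z) + (x m * z - z) - (y - z) := by
      rw [mul_sub]; abel
    have h2 : ‖x m * (y - z)‖ ≤ M * ‖y - z‖ :=
      (norm_mul_le _ _).trans (mul_le_mul_of_nonneg_right (hM m) (norm_nonneg _))
    have h3 := norm_sub_le (x m * (y - z) + (x m * z - z)) (y - z)
    have h4 := norm_add_le (x m * (y - z)) (x m * z - z)
    rw [h1]
    linarith
  simpa only [hxy] using hyl

end ApproximateUnit

section UniformSeparation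

variable {A : Type*} [NonUnitalNormedRing A] [CompleteSpace A]

/-- An approximate identity of a closed set without identity element stays away, along any
ultrafilter, from each given point. -/
theorem exists_eventually_separated {B : Set A} (hB : IsClosed B) {Λ : Type*}
    (U : Ultrafilter Λ) {e : Λ → A} (he : ∀ α, e α ∈ B)
    (hr : ∀ b ∈ B, Tendsto (fun α => b * e α) U (𝓝 b))
    (hl : ∀ b ∈ B, Tendsto (fun α => e α * b) U (𝓝 b))
    (hunit : ¬ ∃ u ∈ B, ∀ b ∈ B, u * b = b ∧ b * u = b) :
    ∃ ε > 0, ∀ b, ∀ᶠ α in U, ε ≤ ‖b - e α‖ := by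
  by_contra! hcon
  have hcauchy : Cauchy (map e U) := by
    refine Metric.cauchy_iff.2 ⟨inferInstance, fun ε hε => ?_⟩
    obtain ⟨b, hb⟩ := hcon (ε / 2) (by positivity)
    refine ⟨Metric.ball b (ε / 2), ?_, fun x hx y hy => ?_⟩
    · refine mem_map.2 ?_
      filter_upwards [hb] with α hα
      rwa [Set.mem_preimage, Metric.mem_ball, dist_comm, dist_eq_norm]
    · linarith [dist_triangle_right x y b, Metric.mem_ball.1 hx, Metric.mem_ball.1 hy]
  obtain ⟨u, hu⟩ := CompleteSpace.complete hcauchy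
  have hu' : Tendsto e U (𝓝 u) := hu
  exact hunit ⟨u, hB.mem_of_tendsto hu' (.of_forall he), fun b hb =>
    ⟨tendsto_nhds_unique (hu'.mul_const b) (hl b hb),
      tendsto_nhds_unique (hu'.const_mul b) (hr b hb)⟩⟩

end UniformSeparation

/-- A surjection of `A*/W(A)` onto `ℓ∞` makes a separable algebra extremely non-Arens regular. -/
theorem ExtremelyNonArensRegular.of_surjective {𝕜 A : Type u} [RCLike 𝕜] [NonUnitalNormedRing A]
    [NormedSpace 𝕜 A] [IsScalarTower 𝕜 A A] [SMulCommClass 𝕜 A A]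
    [TopologicalSpace.SeparableSpace A]
    {T : ((A →L[𝕜] 𝕜) ⧸ WAP 𝕜 A) →L[𝕜] lp (fun _ : ℕ => 𝕜) ∞} (hT : Function.Surjective T) :
    ExtremelyNonArensRegular 𝕜 A := by
  obtain ⟨ι⟩ := exists_dual_linearIsometry_lp (𝕜 := 𝕜) (E := A)
  let R := LinearMap.range ι.toLinearMap
  have hR : IsClosed (R : Set (lp (fun _ : ℕ => 𝕜) ∞)) := by
    have : (R : Set (lp (fun _ : ℕ => 𝕜) ∞)) = Set.range ι := by
      ext; simp [R]
    rw [this]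
    exact ι.isometry.isClosedEmbedding.isClosed_range
  let S : Submodule 𝕜 ((A →L[𝕜] 𝕜) ⧸ WAP 𝕜 A) := R.comap T.toLinearMap
  let T' : S →L[𝕜] R := (T.comp S.subtypeL).codRestrict R fun x => x.2
  refine ⟨S, hR.preimage T.continuous,
    (ι.equivRange.symm.toContinuousLinearEquiv : R →L[𝕜] A →L[𝕜] 𝕜).comp T',
    ι.equivRange.symm.surjective.comp fun r => ?_⟩
  obtain ⟨q, hq⟩ := hT r
  have hqS : q ∈ S := by
    change T q ∈ R
    rw [hq]
    exact r.2
  exact ⟨⟨q, hqS⟩, Subtype.ext hq⟩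

/-- if a Banach algebra `A` contains a closed subalgebra `B` which has no
identity element, is weakly sequentially complete and has a bounded approximate identity,
then (i) there is a bounded linear surjection from `A*/W(A)` onto `ℓ∞ = ℓ∞(ℕ)`; (ii) in
particular `A` is not Arens regular; and (iii) if `A` is moreover separable, then `A` is
extremely non-Arens regular. -/
theorem statement8 (𝕜 A : Type u) [RCLike 𝕜] [NonUnitalNormedRing A] [NormedSpace 𝕜 A]
    [IsScalarTower 𝕜 A A] [SMulCommClass 𝕜 A A] [CompleteSpace A]
    (B : NonUnitalSubalgebra 𝕜 A) (hBclosed : IsClosed (B : Set A))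
    -- `B` has no identity element
    (hBnounit : ¬ ∃ u ∈ B, ∀ b ∈ B, u * b = b ∧ b * u = b)
    -- `B` is weakly sequentially complete
    (hBwsc : ∀ x : ℕ → A, (∀ n, x n ∈ B) →
      (∀ f : A →L[𝕜] 𝕜, ∃ l : 𝕜, Filter.Tendsto (fun n => f (x n)) Filter.atTop (nhds l)) →
      ∃ y ∈ B, ∀ f : A →L[𝕜] 𝕜,
        Filter.Tendsto (fun n => f (x n)) Filter.atTop (nhds (f y)))
    -- `B` has a bounded approximate identity
    (Λ : Type u) [Preorder Λ] [Nonempty Λ] [IsDirected Λ (· ≤ ·)]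
    (e : Λ → A) (he : ∀ α, e α ∈ B) (M : ℝ) (hM : ∀ α, ‖e α‖ ≤ M)
    (hbai : ∀ b ∈ B,
      Filter.Tendsto (fun α => ‖b * e α - b‖) Filter.atTop (nhds 0) ∧
      Filter.Tendsto (fun α => ‖e α * b - b‖) Filter.atTop (nhds 0)) :
    (∃ T : ((A →L[𝕜] 𝕜) ⧸ WAP 𝕜 A) →L[𝕜] lp (fun _ : ℕ => 𝕜) ∞, Function.Surjective T) ∧
    WAP 𝕜 A ≠ ⊤ ∧
    (TopologicalSpace.SeparableSpace A → ExtremelyNonArensRegular 𝕜 A) := by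
  let U : Ultrafilter Λ := Ultrafilter.of atTop
  have hU : (U : Filter Λ) ≤ atTop := Ultrafilter.of_le _
  have hr : ∀ b ∈ (B : Set A), Tendsto (fun α => b * e α) U (𝓝 b) := fun b hb =>
    tendsto_iff_norm_sub_tendsto_zero.2 ((hbai b hb).1.mono_left hU)
  have hl : ∀ b ∈ (B : Set A), Tendsto (fun α => e α * b) U (𝓝 b) := fun b hb =>
    tendsto_iff_norm_sub_tendsto_zero.2 ((hbai b hb).2.mono_left hU)
  obtain ⟨ε, hε, hsep⟩ := exists_eventually_separated hBclosed U he hr hl hBnounit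
  obtain ⟨α, hαsep, hαr, hαl⟩ := exists_separated_approximateUnit U he hr hl hsep
  obtain ⟨φ, hφ, δ, hδ, hl1⟩ := exists_l1_subsequence (𝕜 := 𝕜) (fun n => hM (α n)) (by
    rintro ⟨φ, hφ, hcauchy⟩
    obtain ⟨y, -, hy⟩ := hBwsc (fun n => e (α (φ n))) (fun n => he _) hcauchy
    have hlim := tendsto_of_weakly_convergent_subsequence (𝕜 := 𝕜) (x := fun n => e (α n))
      (fun n => hM (α n)) hαr hαl hφ hy
    obtain ⟨N, hN⟩ := Metric.cauchySeq_iff.1 hlim.cauchySeq ε hε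
    have h1 := hN N le_rfl (N + 1) N.le_succ
    rw [dist_eq_norm] at h1
    exact absurd h1 (not_lt.2 (hαsep N (N + 1) N.lt_succ_self)))
  obtain ⟨T, hT⟩ := exists_surjective_of_l1_approximateUnit (x := fun n => e (α (φ n)))
    (fun n => hM _) (fun n => (hαr _).comp hφ.tendsto_atTop)
    (fun n => (hαl _).comp hφ.tendsto_atTop) hδ hl1
  refine ⟨⟨T, hT⟩, fun htop => ?_, fun _ => ExtremelyNonArensRegular.of_surjective hT⟩
  have : Subsingleton ((A →L[𝕜] 𝕜) ⧸ WAP 𝕜 A) := Submodule.Quotient.subsingleton_iff.2 htop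
  have := hT.subsingleton
  have h01 : lp.single (E := fun _ : ℕ => 𝕜) ∞ 0 1 = 0 := Subsingleton.elim _ _
  simpa using congrArg (fun c : lp (fun _ : ℕ => 𝕜) ∞ => c 0) h01

end Paper
end
end

section
/- Let B be a weakly sequentially complete Banach algebra without identity element which has a bounded approximate identity that is a sequence (x_n)_{n∈ℕ}. Then (x_n) has no weakly Cauchy subsequence; consequently, by Rosenthal's ℓ¹-theorem, some subsequence of (x_n) is an ℓ¹(ℵ₀)-base in B. -/
open Filter Topology

noncomputable section

universe u

namespace Paper

/-- Greedy construction of a strictly increasing sequence along which a state evolves: if in every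
admissible state infinitely many moves lead to an admissible state, there is an infinite play with
strictly increasing moves. -/
theorem exists_strictMono_play {σ : Type*} (inv : σ → Prop) (next : σ → ℕ → σ)
    (s₀ : σ) (h₀ : inv s₀) (h : ∀ s, inv s → ∃ᶠ n in atTop, inv (next s n)) :
    ∃ (m : ℕ → ℕ) (st : ℕ → σ), StrictMono m ∧ st 0 = s₀ ∧
      (∀ i, st (i + 1) = next (st i) (m i)) ∧ ∀ i, inv (st i) := by
  have h' : ∀ q : {q : σ × ℕ // inv q.1}, ∃ n, q.1.2 ≤ n ∧ inv (next q.1.1 n) :=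
    fun q => frequently_atTop.1 (h q.1.1 q.2) q.1.2
  choose f hf using h'
  let q : ℕ → {q : σ × ℕ // inv q.1} := fun i =>
    Nat.rec ⟨(s₀, 0), h₀⟩ (fun _ q => ⟨(next q.1.1 (f q), f q + 1), (hf q).2⟩) i
  refine ⟨fun i => f (q i), fun i => (q i).1.1, strictMono_nat_of_lt_succ fun i => ?_, rfl,
    fun i => rfl, fun i => (q i).2⟩
  exact (hf (q (i + 1))).1

/-- Trees witnessing that, for ultrafilter many choices, suitable intersections become empty. -/
inductive WitnessTree : Type
  | leaf : WitnessTree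
  | node : Bool → (ℕ → WitnessTree) → WitnessTree

namespace WitnessTree

variable {S : Type*}

/-- The tree `t` witnesses that `E` becomes empty after intersecting with sets `A b n`, the signs
`b` being dictated by the tree and `n` ranging over sets of `U`. -/
def Valid (U : Ultrafilter ℕ) (A : Bool → ℕ → Set S) : WitnessTree → Set S → Prop
  | leaf, E => E = ∅
  | node b c, E => ∀ᶠ n in (U : Filter ℕ), Valid U A (c n) (E ∩ A b n)

/-- The sign at the root of a tree (arbitrary for a leaf). -/
def sign : WitnessTree → Bool
  | leaf => true
  | node b _ => b

/-- The subtree at a child of the root (a leaf for a leaf). -/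
def child : WitnessTree → ℕ → WitnessTree
  | leaf, _ => leaf
  | node _ c, n => c n

theorem Valid.eventually {U : Ultrafilter ℕ} {A : Bool → ℕ → Set S} {t : WitnessTree} {E : Set S}
    (h : Valid U A t E) : ∀ᶠ n in (U : Filter ℕ), Valid U A (t.child n) (E ∩ A t.sign n) := by
  cases t with
  | leaf =>
    have hE : E = ∅ := h
    simp [child, Valid, hE]
  | node b c => exact h

theorem exists_valid_of_eventually {U : Ultrafilter ℕ} {A : Bool → ℕ → Set S} {E : Set S} (b : Bool)
    (h : ∀ᶠ n in (U : Filter ℕ), ∃ t, Valid U A t (E ∩ A b n)) : ∃ t, Valid U A t E := by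
  classical
  refine ⟨node b fun n => if h : ∃ t, Valid U A t (E ∩ A b n) then h.choose else leaf, ?_⟩
  filter_upwards [h] with n hn
  simpa [hn] using hn.choose_spec

end WitnessTree

open WitnessTree in
/-- If no tree witnesses emptiness, some subsequence of pairs of sets is independent. -/
theorem exists_independent_of_not_valid {S : Type*} (A : Bool → ℕ → Set S)
    (h : ¬ ∃ t, Valid (hyperfilter ℕ) A t Set.univ) :
    ∃ m : ℕ → ℕ, StrictMono m ∧ ∀ (p : ℕ) (ε : ℕ → Bool), ∃ g, ∀ i < p, g ∈ A (ε i) (m i) := by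
  classical
  obtain ⟨m, st, hm, h0, hs, hinv⟩ := exists_strictMono_play
    (fun F : Finset (Set S) => ∀ E ∈ F, ¬ ∃ t, Valid (hyperfilter ℕ) A t E)
    (fun F n => F.image (· ∩ A true n) ∪ F.image (· ∩ A false n)) {Set.univ} (by simpa using h) (by
      intro F hF
      have key : ∀ᶠ n in (hyperfilter ℕ : Filter ℕ), ∀ E ∈ F, ∀ b,
          ¬ ∃ t, Valid (hyperfilter ℕ) A t (E ∩ A b n) := by
        rw [Filter.eventually_all_finset]
        intro E hE
        rw [Filter.eventually_all]
        intro b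
        rw [Ultrafilter.eventually_not]
        exact fun hb => hF E hE (exists_valid_of_eventually b hb)
      refine (key.frequently.filter_mono Nat.hyperfilter_le_atTop).mono fun n hn => ?_
      intro E hE
      simp only [Finset.mem_union, Finset.mem_image] at hE
      rcases hE with ⟨E', hE', rfl⟩ | ⟨E', hE', rfl⟩
      · exact hn E' hE' true
      · exact hn E' hE' false)
  refine ⟨m, hm, fun p ε => ?_⟩
  have hmem : {g | ∀ i < p, g ∈ A (ε i) (m i)} ∈ st p := by
    induction p with
    | zero => simp [h0]
    | succ p ih =>
      have heq : {g | ∀ i < p + 1, g ∈ A (ε i) (m i)} =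
          {g | ∀ i < p, g ∈ A (ε i) (m i)} ∩ A (ε p) (m p) := by
        ext g
        simp only [Set.mem_ofPred_eq, Set.mem_inter_iff]
        exact Nat.forall_lt_succ_right
      rw [heq, hs, Finset.mem_union, Finset.mem_image, Finset.mem_image]
      cases hb : ε p
      · exact Or.inr ⟨_, ih, rfl⟩
      · exact Or.inl ⟨_, ih, rfl⟩
  by_contra hne
  refine hinv p _ hmem ⟨leaf, ?_⟩
  exact Set.eq_empty_of_forall_notMem fun g hg => hne ⟨g, hg⟩

open WitnessTree in
/-- If every one of countably many sequences of pairs of sets has a witness of emptiness, then all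
of them converge along a common subsequence. -/
theorem exists_convergent_of_valid {S : Type*} (A : ℕ → Bool → ℕ → Set S)
    (h : ∀ k, ∃ t, Valid (hyperfilter ℕ) (A k) t Set.univ) :
    ∃ m : ℕ → ℕ, StrictMono m ∧
      ∀ k g, ¬ ∀ b, ∃ᶠ i in atTop, g ∈ A k b (m i) := by
  classical
  choose root hroot using h
  obtain ⟨m, st, hm, -, hs, hinv⟩ := exists_strictMono_play
    (fun F : Finset (ℕ × WitnessTree × Set S) =>
      ∀ q ∈ F, Valid (hyperfilter ℕ) (A q.1) q.2.1 q.2.2)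
    (fun F n => (F ∪ F.image fun q => (q.1, q.2.1.child n, q.2.2 ∩ A q.1 q.2.1.sign n)) ∪
      (Finset.range (n + 1)).image fun k => (k, root k, Set.univ)) ∅ (by simp) (by
      intro F hF
      have key : ∀ᶠ n in (hyperfilter ℕ : Filter ℕ), ∀ q ∈ F,
          Valid (hyperfilter ℕ) (A q.1) (q.2.1.child n) (q.2.2 ∩ A q.1 q.2.1.sign n) := by
        rw [Filter.eventually_all_finset]
        exact fun q hq => (hF q hq).eventually
      refine (key.frequently.filter_mono Nat.hyperfilter_le_atTop).mono fun n hn => ?_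
      intro q hq
      simp only [Finset.mem_union, Finset.mem_image] at hq
      rcases hq with (hq | ⟨q', hq', rfl⟩) | ⟨k, -, rfl⟩
      · exact hF q hq
      · exact hn q' hq'
      · exact hroot k)
  have hmono : Monotone st := monotone_nat_of_le_succ fun i => by
    rw [hs]
    exact Finset.subset_union_left.trans Finset.subset_union_left
  refine ⟨m, hm, fun k g hg => ?_⟩
  have key : ∀ (t : WitnessTree) (E : Set S) (i : ℕ), (k, t, E) ∈ st i → g ∉ E := by
    intro t
    induction t with
    | leaf =>
      intro E i hi
      have hE : E = ∅ := hinv i _ hi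
      simp [hE]
    | node b c ih =>
      intro E i hi hgE
      obtain ⟨i', hii', hgi'⟩ := frequently_atTop.1 (hg b) i
      refine ih (m i') (E ∩ A k b (m i')) (i' + 1) ?_ ⟨hgE, hgi'⟩
      rw [hs]
      exact Finset.mem_union_left _ (Finset.mem_union_right _
        (Finset.mem_image.2 ⟨_, hmono hii' hi, rfl⟩))
  refine key (root k) Set.univ (k + 1) ?_ (Set.mem_univ g)
  rw [hs]
  exact Finset.mem_union_right _ (Finset.mem_image.2
    ⟨k, Finset.mem_range.2 (Nat.lt_succ_of_le (hm.id_le k)), rfl⟩)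

/-- Rosenthal's dichotomy: if no subsequence converges for all of countably many sequences of pairs
of sets, one of these sequences has an independent subsequence. -/
theorem exists_independent_subsequence_s9 {S ι : Type*} [Countable ι] [Nonempty ι]
    (A : ι → Bool → ℕ → Set S)
    (h : ∀ m : ℕ → ℕ, StrictMono m → ∃ k g, ∀ b, ∃ᶠ i in atTop, g ∈ A k b (m i)) :
    ∃ (k : ι) (m : ℕ → ℕ), StrictMono m ∧
      ∀ (p : ℕ) (ε : ℕ → Bool), ∃ g, ∀ i < p, g ∈ A k (ε i) (m i) := by
  obtain ⟨e, he⟩ := exists_surjective_nat ι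
  by_contra! hcon
  obtain ⟨m, hm, hconv⟩ := exists_convergent_of_valid (fun k => A (e k)) fun k => by
    by_contra hk
    obtain ⟨m, hm, hind⟩ := exists_independent_of_not_valid (A (e k)) hk
    obtain ⟨p, ε, hp⟩ := hcon (e k) m hm
    obtain ⟨g, hg⟩ := hind p ε
    obtain ⟨i, hi, hgi⟩ := hp g
    exact hgi (hg i hi)
  obtain ⟨k, g, hg⟩ := h m hm
  obtain ⟨k, rfl⟩ := he k
  exact hconv k g hg

/-- A bounded divergent scalar sequence visits infinitely often two balls, taken from a countable
family, whose distance is large compared with their radius. -/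
theorem exists_frequently_mem_ball {𝕜 : Type*} [RCLike 𝕜] (u : ℕ → 𝕜) (C : ℝ)
    (hC : ∀ n, ‖u n‖ ≤ C) (hu : ¬ ∃ l, Tendsto u atTop (𝓝 l)) :
    ∃ (c : Bool → ℕ) (r : ℕ),
      8 * ((r : ℝ) + 1)⁻¹ ≤ ‖TopologicalSpace.denseSeq 𝕜 (c true) -
        TopologicalSpace.denseSeq 𝕜 (c false)‖ ∧
      ∀ b, ∃ᶠ n in atTop,
        u n ∈ Metric.ball (TopologicalSpace.denseSeq 𝕜 (c b)) ((r : ℝ) + 1)⁻¹ := by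
  have hcpt : IsCompact (Metric.closedBall (0 : 𝕜) C) := isCompact_closedBall 0 C
  have hmem : ∀ n, u n ∈ Metric.closedBall (0 : 𝕜) C := fun n => by simpa using hC n
  obtain ⟨x, -, hx⟩ := hcpt.exists_mapClusterPt_of_frequently (l := atTop) (f := u)
    (Eventually.of_forall hmem).frequently
  obtain ⟨y, hy, hyx⟩ : ∃ y, MapClusterPt y atTop u ∧ y ≠ x := by
    by_contra! hcon
    exact hu ⟨x, hcpt.tendsto_nhds_of_unique_mapClusterPt (Eventually.of_forall hmem)
      fun y _ hy => hcon y hy⟩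
  obtain ⟨r, hr⟩ := exists_nat_one_div_lt (div_pos (norm_pos_iff.2 (sub_ne_zero.2 hyx))
    (by norm_num : (0 : ℝ) < 10))
  have hρ : (0 : ℝ) < ((r : ℝ) + 1)⁻¹ := by positivity
  rw [one_div] at hr
  obtain ⟨i, hi⟩ := (TopologicalSpace.denseRange_denseSeq 𝕜).exists_dist_lt x hρ
  obtain ⟨j, hj⟩ := (TopologicalSpace.denseRange_denseSeq 𝕜).exists_dist_lt y hρ
  refine ⟨fun b => cond b i j, r, ?_, ?_⟩
  · have h1 := dist_triangle4 y (TopologicalSpace.denseSeq 𝕜 j) (TopologicalSpace.denseSeq 𝕜 i) x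
    rw [dist_comm (TopologicalSpace.denseSeq 𝕜 i) x,
      dist_comm _ (TopologicalSpace.denseSeq 𝕜 i)] at h1
    simp only [cond_true, cond_false]
    rw [← dist_eq_norm] at hr ⊢
    linarith
  · rintro (_ | _)
    · exact hy.frequently (Metric.isOpen_ball.mem_nhds hj)
    · exact hx.frequently (Metric.isOpen_ball.mem_nhds hi)

/-- Functionals realising all sign patterns approximately on a finite family bound the signed sums
of its coefficients. -/
theorem norm_signed_sum_le {𝕜 E : Type*} [RCLike 𝕜] [NormedAddCommGroup E] [NormedSpace 𝕜 E]
    {ι : Type*} [Fintype ι] (c : Bool → 𝕜) (ρ : ℝ) (y : ι → E)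
    (h : ∀ ε : ι → Bool, ∃ g : E →L[𝕜] 𝕜, ‖g‖ ≤ 1 ∧ ∀ n, ‖g (y n) - c (ε n)‖ ≤ ρ)
    (z : ι → 𝕜) (ε : ι → Bool) :
    ‖c true - c false‖ * ‖∑ n, z n * (if ε n then 1 else -1)‖ ≤
      2 * ‖∑ n, z n • y n‖ + 2 * ρ * ∑ n, ‖z n‖ := by
  obtain ⟨g₁, hg₁, h₁⟩ := h ε
  obtain ⟨g₂, hg₂, h₂⟩ := h fun n => !ε n
  have hsplit : (c true - c false) * ∑ n, z n * (if ε n then 1 else -1) =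
      (g₁ (∑ n, z n • y n) - g₂ (∑ n, z n • y n)) -
        ∑ n, z n * ((g₁ (y n) - c (ε n)) - (g₂ (y n) - c (!ε n))) := by
    simp only [map_sum, map_smul, smul_eq_mul, Finset.mul_sum, ← Finset.sum_sub_distrib]
    refine Finset.sum_congr rfl fun n _ => ?_
    cases ε n <;> simp <;> ring
  have hb₁ := g₁.le_of_opNorm_le hg₁ (∑ n, z n • y n)
  have hb₂ := g₂.le_of_opNorm_le hg₂ (∑ n, z n • y n)
  have herr : ‖∑ n, z n * ((g₁ (y n) - c (ε n)) - (g₂ (y n) - c (!ε n)))‖ ≤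
      2 * ρ * ∑ n, ‖z n‖ := by
    rw [Finset.mul_sum]
    refine norm_sum_le_of_le _ fun n _ => ?_
    rw [norm_mul, mul_comm]
    refine mul_le_mul_of_nonneg_right ?_ (norm_nonneg _)
    linarith [norm_sub_le (g₁ (y n) - c (ε n)) (g₂ (y n) - c (!ε n)), h₁ n, h₂ n]
  rw [← norm_mul, hsplit]
  refine (norm_sub_le _ _).trans (add_le_add ?_ herr)
  linarith [norm_sub_le (g₁ (∑ n, z n • y n)) (g₂ (∑ n, z n • y n))]

theorem rclike_norm_le_abs_re_add_abs_im {𝕜 : Type*} [RCLike 𝕜] (z : 𝕜) :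
    ‖z‖ ≤ |RCLike.re z| + |RCLike.im z| := by
  refine abs_le_of_sq_le_sq' ?_ (by positivity) |>.2
  rw [RCLike.norm_sq_eq_def, add_sq, sq_abs, sq_abs, sq, sq]
  nlinarith [mul_nonneg (abs_nonneg (RCLike.re z)) (abs_nonneg (RCLike.im z))]

/-- A finite family on which functionals approximately realise all sign patterns satisfies a lower
`ℓ¹`-estimate. -/
theorem sum_norm_le_of_sign_patterns {𝕜 E : Type*} [RCLike 𝕜] [NormedAddCommGroup E]
    [NormedSpace 𝕜 E] {ι : Type*} [Fintype ι] (c : Bool → 𝕜) {ρ : ℝ} (hρ : 0 < ρ)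
    (hc : 8 * ρ ≤ ‖c true - c false‖) (y : ι → E)
    (h : ∀ ε : ι → Bool, ∃ g : E →L[𝕜] 𝕜, ‖g‖ ≤ 1 ∧ ∀ n, ‖g (y n) - c (ε n)‖ ≤ ρ)
    (z : ι → 𝕜) : ∑ n, ‖z n‖ ≤ ρ⁻¹ * ‖∑ n, z n • y n‖ := by
  have hre : ∑ n, |RCLike.re (z n)| ≤
      ‖∑ n, z n * (if decide (0 ≤ RCLike.re (z n)) then 1 else -1)‖ := by
    refine le_trans (le_of_eq ?_) (RCLike.re_le_norm _)
    rw [map_sum]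
    refine Finset.sum_congr rfl fun n _ => ?_
    by_cases hn : 0 ≤ RCLike.re (z n)
    · simp [hn, abs_of_nonneg hn]
    · simp [hn, abs_of_neg (not_le.1 hn)]
  have him : ∑ n, |RCLike.im (z n)| ≤
      ‖∑ n, z n * (if decide (0 ≤ RCLike.im (z n)) then 1 else -1)‖ := by
    refine le_trans (le_of_eq ?_) (RCLike.im_le_norm _)
    rw [map_sum]
    refine Finset.sum_congr rfl fun n _ => ?_
    by_cases hn : 0 ≤ RCLike.im (z n)
    · simp [hn, abs_of_nonneg hn]
    · simp [hn, abs_of_neg (not_le.1 hn)]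
  have h1 := norm_signed_sum_le c ρ y h z fun n => decide (0 ≤ RCLike.re (z n))
  have h2 := norm_signed_sum_le c ρ y h z fun n => decide (0 ≤ RCLike.im (z n))
  have hsum : ∑ n, ‖z n‖ ≤ ∑ n, |RCLike.re (z n)| + ∑ n, |RCLike.im (z n)| := by
    rw [← Finset.sum_add_distrib]
    exact Finset.sum_le_sum fun n _ => rclike_norm_le_abs_re_add_abs_im (z n)
  have h3 : 8 * ρ * ∑ n, ‖z n‖ ≤ ‖c true - c false‖ * ∑ n, ‖z n‖ := by gcongr
  have h4 : ‖c true - c false‖ * ∑ n, ‖z n‖ ≤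
      4 * ‖∑ n, z n • y n‖ + 4 * ρ * ∑ n, ‖z n‖ := by
    have := mul_le_mul_of_nonneg_left (hsum.trans (add_le_add hre him))
      (norm_nonneg (c true - c false))
    linarith
  rw [le_inv_mul_iff₀ hρ]
  linarith

/-- Rosenthal's `ℓ¹`-theorem: a bounded sequence without weakly Cauchy subsequence has a
subsequence equivalent to the unit vector basis of `ℓ¹`. -/
theorem rosenthal_l1 {𝕜 E : Type*} [RCLike 𝕜] [NormedAddCommGroup E] [NormedSpace 𝕜 E]
    (x : ℕ → E) (M : ℝ) (hM : ∀ n, ‖x n‖ ≤ M)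
    (hx : ∀ φ : ℕ → ℕ, StrictMono φ →
      ¬ ∀ f : E →L[𝕜] 𝕜, ∃ l : 𝕜, Tendsto (fun n => f (x (φ n))) atTop (𝓝 l)) :
    ∃ φ : ℕ → ℕ, StrictMono φ ∧ ∃ K : ℝ, 0 < K ∧
      ∀ (p : ℕ) (z : Fin p → 𝕜) (j : Fin p → ℕ), Function.Injective j →
        ∑ n, ‖z n‖ ≤ K * ‖∑ n, z n • x (φ (j n))‖ := by
  let d := TopologicalSpace.denseSeq 𝕜
  obtain ⟨⟨c, r⟩, φ, hφ, hind⟩ := exists_independent_subsequence_s9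
    (fun (k : (Bool → ℕ) × ℕ) b n => {g : E →L[𝕜] 𝕜 | ‖g‖ ≤ 1 ∧
      8 * ((k.2 : ℝ) + 1)⁻¹ ≤ ‖d (k.1 true) - d (k.1 false)‖ ∧
      g (x n) ∈ Metric.ball (d (k.1 b)) ((k.2 : ℝ) + 1)⁻¹}) (by
    intro φ hφ
    obtain ⟨f, hf⟩ := not_forall.1 (hx φ hφ)
    have hpos : 0 < ‖f‖ + 1 := by positivity
    have ha : ((‖f‖ + 1 : ℝ) : 𝕜) ≠ 0 := by exact_mod_cast hpos.ne'
    let g : E →L[𝕜] 𝕜 := ((‖f‖ + 1 : ℝ) : 𝕜)⁻¹ • f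
    have hg : ‖g‖ ≤ 1 := by
      rw [norm_smul, norm_inv, RCLike.norm_ofReal, abs_of_pos hpos, inv_mul_le_one₀ hpos]
      linarith
    obtain ⟨c, r, hcr, hfreq⟩ := exists_frequently_mem_ball (fun n => g (x (φ n))) (1 * M)
      (fun n => g.le_of_opNorm_le_of_le hg (hM _)) (by
        rintro ⟨l, hl⟩
        refine hf ⟨((‖f‖ + 1 : ℝ) : 𝕜) * l, (hl.const_mul _).congr fun n => ?_⟩
        exact mul_inv_cancel_left₀ ha _)
    exact ⟨(c, r), g, fun b => (hfreq b).mono fun n hn => ⟨hg, hcr, hn⟩⟩)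
  have hρ : (0 : ℝ) < ((r : ℝ) + 1)⁻¹ := by positivity
  have hsep : 8 * ((r : ℝ) + 1)⁻¹ ≤ ‖d (c true) - d (c false)‖ := by
    obtain ⟨g, hg⟩ := hind 1 fun _ => true
    exact (hg 0 one_pos).2.1
  refine ⟨φ, hφ, (((r : ℝ) + 1)⁻¹)⁻¹, inv_pos.2 hρ, fun p z j hj =>
    sum_norm_le_of_sign_patterns (fun b => d (c b)) hρ hsep _ (fun ε => ?_) z⟩
  obtain ⟨N, hN⟩ := (Set.finite_range j).bddAbove
  obtain ⟨g, hg⟩ := hind (N + 1) (Function.extend j ε fun _ => true)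
  have hlt : ∀ n, j n < N + 1 := fun n => Nat.lt_succ_of_le (hN ⟨n, rfl⟩)
  refine ⟨g, (hg 0 N.succ_pos).1, fun n => ?_⟩
  have := (hg (j n) (hlt n)).2.2
  rw [hj.extend_apply, mem_ball_iff_norm] at this
  exact this.le

/-- A weak limit of a subsequence of an approximate identity is an identity element. -/
theorem isIdentity_of_weak_limit {𝕜 B : Type*} [RCLike 𝕜] [NonUnitalNormedRing B] [NormedSpace 𝕜 B]
    [IsScalarTower 𝕜 B B] [SMulCommClass 𝕜 B B] (x : ℕ → B)
    (hx : ∀ b : B, Tendsto (fun n => ‖b * x n - b‖) atTop (𝓝 0) ∧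
      Tendsto (fun n => ‖x n * b - b‖) atTop (𝓝 0)) (y : B)
    (hy : ∀ f : B →L[𝕜] 𝕜, Tendsto (fun n => f (x n)) atTop (𝓝 (f y))) (b : B) :
    y * b = b ∧ b * y = b := by
  constructor
  · refine (SeparatingDual.eq_iff_forall_dual_eq (R := 𝕜)).2 fun f => ?_
    exact tendsto_nhds_unique (hy (f.comp ((ContinuousLinearMap.mul 𝕜 B).flip b)))
      ((f.continuous.tendsto b).comp (tendsto_iff_norm_sub_tendsto_zero.2 (hx b).2))
  · refine (SeparatingDual.eq_iff_forall_dual_eq (R := 𝕜)).2 fun f => ?_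
    exact tendsto_nhds_unique (hy (f.comp (ContinuousLinearMap.mul 𝕜 B b)))
      ((f.continuous.tendsto b).comp (tendsto_iff_norm_sub_tendsto_zero.2 (hx b).1))

/-- a weakly sequentially complete Banach algebra `B` without identity
element whose bounded approximate identity is a sequence `(xₙ)` is such that `(xₙ)` has no
weakly Cauchy subsequence; consequently (by Rosenthal's `ℓ¹`-theorem) some subsequence of
`(xₙ)` is an `ℓ¹(ℵ₀)`-base in `B`. -/
theorem statement9 (𝕜 B : Type u) [RCLike 𝕜] [NonUnitalNormedRing B] [NormedSpace 𝕜 B]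
    [IsScalarTower 𝕜 B B] [SMulCommClass 𝕜 B B] [CompleteSpace B]
    -- `B` is weakly sequentially complete
    (hwsc : ∀ x : ℕ → B,
      (∀ f : B →L[𝕜] 𝕜, ∃ l : 𝕜, Tendsto (fun n => f (x n)) atTop (𝓝 l)) →
      ∃ y : B, ∀ f : B →L[𝕜] 𝕜, Tendsto (fun n => f (x n)) atTop (𝓝 (f y)))
    -- `B` has no identity element
    (hnounit : ¬ ∃ u : B, ∀ b : B, u * b = b ∧ b * u = b)
    -- `(xₙ)` is a sequential bounded approximate identity
    (x : ℕ → B) (M : ℝ) (hM : ∀ n, ‖x n‖ ≤ M)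
    (hbai : ∀ b : B, Tendsto (fun n => ‖b * x n - b‖) atTop (𝓝 0) ∧
                     Tendsto (fun n => ‖x n * b - b‖) atTop (𝓝 0)) :
    -- no weakly Cauchy subsequence …
    (∀ φ : ℕ → ℕ, StrictMono φ →
      ¬ ∀ f : B →L[𝕜] 𝕜, ∃ l : 𝕜, Tendsto (fun n => f (x (φ n))) atTop (𝓝 l)) ∧
    -- … and some subsequence is an `ℓ¹(ℵ₀)`-base
    (∃ φ : ℕ → ℕ, StrictMono φ ∧ Function.Injective (fun n => x (φ n)) ∧
      ∃ K : ℝ, 0 < K ∧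
        ∀ (p : ℕ) (z : Fin p → 𝕜) (j : Fin p → ℕ), Function.Injective j →
          ∑ n, ‖z n‖ ≤ K * ‖∑ n, z n • x (φ (j n))‖) := by
  have hcauchy : ∀ φ : ℕ → ℕ, StrictMono φ →
      ¬ ∀ f : B →L[𝕜] 𝕜, ∃ l : 𝕜, Tendsto (fun n => f (x (φ n))) atTop (𝓝 l) := by
    intro φ hφ h
    obtain ⟨y, hy⟩ := hwsc (fun n => x (φ n)) h
    exact hnounit ⟨y, isIdentity_of_weak_limit (fun n => x (φ n))
      (fun b => ⟨(hbai b).1.comp hφ.tendsto_atTop, (hbai b).2.comp hφ.tendsto_atTop⟩) y hy⟩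
  obtain ⟨φ, hφ, K, hK, hbase⟩ := rosenthal_l1 x M hM hcauchy
  refine ⟨hcauchy, φ, hφ, fun a b hab => ?_, K, hK, hbase⟩
  by_contra hne
  have hinj : Function.Injective ![a, b] := by
    intro i j hij
    fin_cases i <;> fin_cases j <;> simp_all
  have h2 := hbase 2 ![1, -1] ![a, b] hinj
  have hab' : x (φ a) = x (φ b) := hab
  norm_num [Fin.sum_univ_two, hab'] at h2

end Paper
end
end
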